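/- arXiv:math/9909018 — 3 statements merged into one kernel-verified Lean document; each statement's English description precedes it below -/
import Mathlib

section
/- Let f ∈ K[x_1,…,x_n] with f(0) = 0, suppose the origin is an isolated critical point of f, and suppose the singularity at the origin is weighted homogeneous: K[[x_1,…,x_n]]/(f) ≅ K[[x_1,…,x_n]]/(g) as K-algebras for some weighted homogeneous polynomial g of total degree d; if char K = p > 0, assume p does not divide d. Then in every representation f = Σ_{i=1}^n h_i ∂f/∂x_i with h_1,…,h_n ∈ K[x_1,…,x_n]_m, the elements h_1,…,h_n all lie in the maximal ideal of the local ring K[x_1,…,x_n]_m. -/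
open MvPolynomial

noncomputable section

/-- A polynomial differential `m`-form over `K[x_1,…,x_n]`, recorded by its coefficients:
to each subset `T ⊆ {1,…,n}` of cardinality `m` (the index set `i_1 < ⋯ < i_m` of
`dx_{i_1} ∧ ⋯ ∧ dx_{i_m}`) we assign a polynomial coefficient. -/
abbrev MForm (K : Type*) [CommSemiring K] (n m : ℕ) : Type _ :=
  ∀ T : Finset (Fin n), T.card = m → MvPolynomial (Fin n) K

/-- The wedge product `dg ∧ ω` of the exterior derivative of `g` with an `m`-form `ω`:
its coefficient on `T = {i_0 < ⋯ < i_m}` is `∑ k, (-1)^k (∂g/∂x_{i_k}) ω(T \ {i_k})`. -/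
def wedgeD {K : Type*} [CommRing K] {n m : ℕ} (g : MvPolynomial (Fin n) K)
    (ω : MForm K n m) : MForm K n (m + 1) := fun T hT =>
  ∑ j ∈ T.attach,
    (-1 : MvPolynomial (Fin n) K) ^ (T.filter (fun i => i < j.1)).card *
      pderiv j.1 g * ω (T.erase j.1) (by rw [Finset.card_erase_of_mem j.2]; omega)

/-- `g` is homogeneous of (possibly negative) degree `d : ℤ`; by convention the only
homogeneous polynomial of negative degree is `0`. -/
def HomogZ {K : Type*} [CommSemiring K] {σ : Type*} (g : MvPolynomial σ K) (d : ℤ) : Prop :=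
  g = 0 ∨ ∃ d' : ℕ, (d' : ℤ) = d ∧ g.IsHomogeneous d'

/-- A list of ring elements is a regular sequence when each entry is a nonzerodivisor
modulo the ideal generated by the preceding entries. -/
def IsRegSeq {R : Type*} [CommRing R] (rs : List R) : Prop :=
  ∀ (i : ℕ) (hi : i < rs.length) (x : R),
    rs[i] * x ∈ Ideal.span {y | ∃ (j : ℕ) (hj : j < i), y = rs[j]'(hj.trans hi)} →
    x ∈ Ideal.span {y | ∃ (j : ℕ) (hj : j < i), y = rs[j]'(hj.trans hi)}

/-- The origin is an isolated critical point of (the polynomial map defined by) `h`: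
it is a common zero of all partial derivatives `∂h/∂x_i`, and there is a Zariski-open
neighborhood `U` of the origin (wlog a basic open set `u ≠ 0` with `u(0) ≠ 0`) on which
the origin is the only common zero of the `∂h/∂x_i`. -/
def IsIsolatedCriticalAtZero {K : Type*} [CommSemiring K] {σ : Type*}
    (h : MvPolynomial σ K) : Prop :=
  (∀ i, eval (0 : σ → K) (pderiv i h) = 0) ∧
  ∃ u : MvPolynomial σ K, eval (0 : σ → K) u ≠ 0 ∧
    ∀ y : σ → K, eval y u ≠ 0 → (∀ i, eval y (pderiv i h) = 0) → y = 0

/-- The dehomogenization of `F` in the affine chart `x_j = 1` of `ℙ^{n-1}`, centered at the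
point `a` (which should satisfy `a j = 1`): a polynomial in the `n-1` variables `i ≠ j`. -/
def chartPoly {K : Type*} [CommRing K] {n : ℕ} (F : MvPolynomial (Fin n) K) (j : Fin n)
    (a : Fin n → K) : MvPolynomial {i : Fin n // i ≠ j} K :=
  aeval (fun i : Fin n => if h : i = j then 1 else X ⟨i, h⟩ + C (a i)) F

/-- `g` is weighted homogeneous of total degree `d`: there are positive integer weights
`α_i` with gcd `1` such that every monomial of `g` has weighted degree `d`
(equivalently, `g(λ^{α_1}x_1,…) = λ^d g(x)`). -/
def IsWeightedHomogTD {K : Type*} [CommSemiring K] {σ : Type*} [Fintype σ]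
    (g : MvPolynomial σ K) (d : ℕ) : Prop :=
  ∃ α : σ → ℕ, (∀ i, 0 < α i) ∧ Finset.univ.gcd α = 1 ∧ IsWeightedHomogeneous α g d

/-- The hypersurface `h = 0` has a weighted homogeneous singularity at the origin, of total
degree `d`: the complete local ring `K[[x]]/(h)` is isomorphic as a `K`-algebra to
`K[[x]]/(g)` for some weighted homogeneous `g` of total degree `d`. -/
def WeightedHomogSing {K : Type*} [Field K] {σ : Type*} [Fintype σ]
    (h : MvPolynomial σ K) (d : ℕ) : Prop :=
  ∃ g : MvPolynomial σ K, IsWeightedHomogTD g d ∧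
    Nonempty ((MvPowerSeries σ K ⧸ Ideal.span {(h : MvPowerSeries σ K)}) ≃ₐ[K]
      MvPowerSeries σ K ⧸ Ideal.span {(g : MvPowerSeries σ K)})

/-- The common zero locus, in the projective space `ℙ^{n-1}`, of a set `S` of
(homogeneous) polynomials. -/
def projZeros {K : Type*} [Field K] {n : ℕ} (S : Set (MvPolynomial (Fin n) K)) :
    Set (Projectivization K (Fin n → K)) :=
  {x | ∃ (v : Fin n → K) (hv : v ≠ 0), Projectivization.mk K v hv = x ∧ ∀ g ∈ S, eval v g = 0}

/-- A homogeneous polynomial `G` in `m` variables defines a smooth hypersurface in `ℙ^{m-1}`: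
`G` and its partial derivatives have no common zero in `ℙ^{m-1}`. -/
def SmoothProj {K : Type*} [Field K] {σ : Type*} (G : MvPolynomial σ K) : Prop :=
  ∀ y : σ → K, y ≠ 0 → ¬ (eval y G = 0 ∧ ∀ i, eval y (pderiv i G) = 0)

/-- `F(x_1,…,x_{n-1},0)`, as a polynomial in the first `n-1` variables. -/
def truncAtLast {K : Type*} [CommRing K] {n : ℕ} (F : MvPolynomial (Fin n) K) :
    MvPolynomial (Fin (n - 1)) K :=
  aeval (fun i : Fin n => if h : (i : ℕ) < n - 1 then X (⟨i, h⟩ : Fin (n - 1)) else 0) F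

/-- `F(y_1,…,y_{n-1},1)`, as a polynomial in the first `n-1` variables. -/
def dehomAtLast {K : Type*} [CommRing K] {n : ℕ} (F : MvPolynomial (Fin n) K) :
    MvPolynomial (Fin (n - 1)) K :=
  aeval (fun i : Fin n => if h : (i : ℕ) < n - 1 then X (⟨i, h⟩ : Fin (n - 1)) else 1) F

/-- The point `(b, 1) ∈ K^n` lying over `b ∈ K^{n-1}` (affine chart `x_n = 1`). -/
def liftPt {K : Type*} [CommRing K] {n : ℕ} (b : Fin (n - 1) → K) : Fin n → K :=
  fun i => if h : (i : ℕ) < n - 1 then b ⟨i, h⟩ else 1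

/-- Context of the paper: `f` has degree `δ ≥ 2`, `1 ≤ δ' ≤ δ - 1`, and
`f = f^(δ) + f^(δ') + (terms of degree < δ')`, with `f^(δ')` the (nonzero) homogeneous
component of second-highest degree. -/
def Setup {K : Type*} [Field K] {n : ℕ} (δ δ' : ℕ) (f : MvPolynomial (Fin n) K) : Prop :=
  f.totalDegree = δ ∧ 2 ≤ δ ∧ 1 ≤ δ' ∧ δ' < δ ∧
  (∀ j, δ' < j → j < δ → homogeneousComponent j f = 0) ∧
  homogeneousComponent δ' f ≠ 0

/-- Hypothesis (A): `p ∤ δ`, `p ∤ δ'`; every singular point of the hypersurface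
`f^(δ) = 0` in `ℙ^{n-1}` (taken with a representative normalized by `a j = 1`) is an
isolated singularity, weighted homogeneous of some total degree `d` with `p ∤ d`,
and does not lie on the hypersurface `f^(δ') = 0`. -/
def HypA {K : Type*} [Field K] {n : ℕ} (p δ δ' : ℕ) (f : MvPolynomial (Fin n) K) : Prop :=
  ¬ (p ∣ δ) ∧ ¬ (p ∣ δ') ∧
  ∀ (a : Fin n → K) (j : Fin n), a j = 1 →
    eval a (homogeneousComponent δ f) = 0 →
    (∀ i, eval a (pderiv i (homogeneousComponent δ f)) = 0) →
    IsIsolatedCriticalAtZero (chartPoly (homogeneousComponent δ f) j a) ∧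
    (∃ d : ℕ, ¬ (p ∣ d) ∧ WeightedHomogSing (chartPoly (homogeneousComponent δ f) j a) d) ∧
    eval a (homogeneousComponent δ' f) ≠ 0

/-- Hypothesis (B): `p ∣ δ`, `p ∤ δ'`, the common zero locus of the `∂f^(δ)/∂x_i` in
`ℙ^{n-1}` is finite and nonempty, and none of its points lies on the hypersurface
`f^(δ') = 0`. -/
def HypB {K : Type*} [Field K] {n : ℕ} (p δ δ' : ℕ) (f : MvPolynomial (Fin n) K) : Prop :=
  (p ∣ δ) ∧ ¬ (p ∣ δ') ∧
  (projZeros {g | ∃ i, g = pderiv i (homogeneousComponent δ f)}).Finite ∧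
  (projZeros {g | ∃ i, g = pderiv i (homogeneousComponent δ f)}).Nonempty ∧
  ∀ a : Fin n → K, a ≠ 0 → (∀ i, eval a (pderiv i (homogeneousComponent δ f)) = 0) →
    eval a (homogeneousComponent δ' f) ≠ 0

/-- The localization of the polynomial ring at the maximal ideal of the point `b`. -/
instance evalKerPrime (K : Type*) [Field K] (σ : Type*) (b : σ → K) :
    (RingHom.ker (eval b : MvPolynomial σ K →+* K)).IsPrime := RingHom.ker_isPrime _

/-- The local ring of affine space at the point `b`, i.e. the localization of the
polynomial ring at the maximal ideal of polynomials vanishing at `b`. -/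
abbrev LocAt (K : Type*) [Field K] {σ : Type*} (b : σ → K) :=
  Localization.AtPrime (RingHom.ker (eval b : MvPolynomial σ K →+* K))

/-- The Milnor number of `h` at the point `b`: the `K`-dimension of the quotient of the
local ring at `b` by the ideal generated by the partial derivatives of `h`. -/
def milnorAt {K : Type*} [Field K] {σ : Type*} (b : σ → K) (h : MvPolynomial σ K) : ℕ :=
  Module.finrank K
    ((LocAt K b) ⧸ Ideal.span (Set.range fun i =>
      algebraMap (MvPolynomial σ K) (LocAt K b) (pderiv i h)))

open Classical in
/-- Underlying function of `killVars`. -/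
def killFun (K : Type*) [Field K] (n : ℕ) (s : Finset (Fin n))
    (a : MvPowerSeries (Fin n) K) : MvPowerSeries (Fin n) K :=
  fun m => if ∀ i ∈ s, m i = 0 then MvPowerSeries.coeff m a else 0

open Classical in
lemma coeff_killFun {K : Type*} [Field K] {n : ℕ} (s : Finset (Fin n))
    (a : MvPowerSeries (Fin n) K) (m : Fin n →₀ ℕ) :
    MvPowerSeries.coeff m (killFun K n s a) =
      if ∀ i ∈ s, m i = 0 then MvPowerSeries.coeff m a else 0 := rfl

/-- Substituting `0` for the variables of index in `s`, in a formal power series. -/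
def killVars (K : Type*) [Field K] (n : ℕ) (s : Finset (Fin n)) :
    MvPowerSeries (Fin n) K →+* MvPowerSeries (Fin n) K := by
  classical
  exact
  { toFun := killFun K n s
    map_one' := by
      ext m
      rw [coeff_killFun]
      split_ifs with h
      · rfl
      · rw [MvPowerSeries.coeff_one, if_neg]
        rintro rfl
        simp at h
    map_mul' := by
      intro a b
      ext m
      rw [MvPowerSeries.coeff_mul, coeff_killFun]
      simp only [coeff_killFun]
      split_ifs with h
      · rw [MvPowerSeries.coeff_mul]
        refine Finset.sum_congr rfl fun p hp => ?_
        rw [Finset.HasAntidiagonal.mem_antidiagonal] at hp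
        have h1 : ∀ i ∈ s, p.1 i + p.2 i = 0 := by
          intro i hi
          rw [← h i hi, ← hp]; rfl
        rw [if_pos (fun i hi => by have := h1 i hi; omega),
          if_pos (fun i hi => by have := h1 i hi; omega)]
      · refine (Finset.sum_eq_zero fun p hp => ?_).symm
        rw [Finset.HasAntidiagonal.mem_antidiagonal] at hp
        by_cases h1 : ∀ i ∈ s, p.1 i = 0
        · by_cases h2 : ∀ i ∈ s, p.2 i = 0
          · exfalso
            apply h
            intro i hi
            rw [← hp, Finsupp.add_apply, h1 i hi, h2 i hi]
          · rw [if_neg h2, mul_zero]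
        · rw [if_neg h1, zero_mul]
    map_zero' := by
      ext m
      rw [coeff_killFun]
      simp
    map_add' := by
      intro a b
      ext m
      rw [map_add]
      simp only [coeff_killFun]
      split_ifs <;> simp }

open Classical in
lemma coeff_killVars {K : Type*} [Field K] {n : ℕ} (s : Finset (Fin n))
    (a : MvPowerSeries (Fin n) K) (m : Fin n →₀ ℕ) :
    MvPowerSeries.coeff m (killVars K n s a) =
      if ∀ i ∈ s, m i = 0 then MvPowerSeries.coeff m a else 0 := by
  exact coeff_killFun s a m

lemma mem_ker_killVars {K : Type*} [Field K] {n : ℕ} (s : Finset (Fin n))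
    (a : MvPowerSeries (Fin n) K) :
    a ∈ RingHom.ker (killVars K n s) ↔
      ∀ m : Fin n →₀ ℕ, (∀ i ∈ s, m i = 0) → MvPowerSeries.coeff m a = 0 := by
  classical
  rw [RingHom.mem_ker, MvPowerSeries.ext_iff]
  simp only [coeff_killVars, map_zero, ite_eq_right_iff]

lemma ker_killVars_le {K : Type*} [Field K] {n : ℕ} (s : Finset (Fin n)) :
    RingHom.ker (killVars K n s) ≤
      Ideal.span (Set.range (MvPowerSeries.X : Fin n → MvPowerSeries (Fin n) K)) := by
  classical
  induction s using Finset.induction_on with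
  | empty =>
    intro a ha
    rw [mem_ker_killVars] at ha
    have : a = 0 := by
      ext m
      simpa using ha m (by simp)
    rw [this]; exact zero_mem _
  | insert j s hj ih =>
    intro a ha
    rw [mem_ker_killVars] at ha
    have h1 : killVars K n {j} a ∈ RingHom.ker (killVars K n s) := by
      rw [mem_ker_killVars]
      intro m hm
      rw [coeff_killVars]
      split_ifs with h
      · apply ha
        intro i hi
        rcases Finset.mem_insert.1 hi with rfl | hi
        · exact h _ (by simp)
        · exact hm i hi
      · rfl
    have h2 : (MvPowerSeries.X j : MvPowerSeries (Fin n) K) ∣ a - killVars K n {j} a := by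
      rw [MvPowerSeries.X_dvd_iff]
      intro m hm
      rw [map_sub, coeff_killVars, if_pos (by simpa using hm), sub_self]
    have h3 : a - killVars K n {j} a ∈
        Ideal.span (Set.range (MvPowerSeries.X : Fin n → MvPowerSeries (Fin n) K)) :=
      Ideal.mem_of_dvd _ h2 (Ideal.subset_span ⟨j, rfl⟩)
    have := Ideal.add_mem _ h3 (ih h1)
    simpa using this

lemma mem_span_X_of_constantCoeff {K : Type*} [Field K] {n : ℕ} (a : MvPowerSeries (Fin n) K)
    (ha : MvPowerSeries.constantCoeff a = 0) :
    a ∈ Ideal.span (Set.range (MvPowerSeries.X : Fin n → MvPowerSeries (Fin n) K)) := by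
  apply ker_killVars_le Finset.univ
  rw [mem_ker_killVars]
  intro m hm
  have : m = 0 := by
    ext i
    exact hm i (Finset.mem_univ _)
  rw [this]
  simpa using ha

instance killVarsPrime (K : Type*) [Field K] (n : ℕ) (s : Finset (Fin n)) :
    (RingHom.ker (killVars K n s)).IsPrime := by
  have : IsDomain (MvPowerSeries (Fin n) K) := NoZeroDivisors.to_isDomain _
  exact RingHom.ker_isPrime _

lemma card_le_height_killVars {K : Type*} [Field K] {n : ℕ} (s : Finset (Fin n)) :
    (s.card : ℕ∞) ≤ (RingHom.ker (killVars K n s)).height := by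
  classical
  induction s using Finset.induction_on with
  | empty => simp
  | insert j s hj ih =>
    have hlt : RingHom.ker (killVars K n s) < RingHom.ker (killVars K n (insert j s)) := by
      refine lt_of_le_of_ne ?_ ?_
      · intro a ha
        rw [mem_ker_killVars] at ha ⊢
        exact fun m hm => ha m fun i hi => hm i (Finset.mem_insert_of_mem hi)
      · intro h
        have h1 : (MvPowerSeries.X j : MvPowerSeries (Fin n) K) ∈
            RingHom.ker (killVars K n (insert j s)) := by
          rw [mem_ker_killVars]
          intro m hm
          rw [MvPowerSeries.coeff_X, if_neg]
          rintro rfl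
          simpa using hm j (Finset.mem_insert_self _ _)
        rw [← h, mem_ker_killVars] at h1
        have := h1 (Finsupp.single j 1) (by
          intro i hi
          rw [Finsupp.single_apply, if_neg]
          rintro rfl
          exact hj hi)
        simp at this
    rw [Finset.card_insert_of_notMem hj]
    push_cast
    exact (add_le_add_left ih 1).trans (Ideal.height_add_one_le_of_lt_of_isPrime hlt)

/-- Krull: fewer than `n` elements cannot generate an ideal primary to the maximal ideal. -/
lemma no_small_primary {K : Type*} [Field K] {n : ℕ} (s : Finset (MvPowerSeries (Fin n) K))
    (hs : s.card < n) (h0 : ∀ a ∈ s, MvPowerSeries.constantCoeff a = 0)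
    (hX : ∀ i, (MvPowerSeries.X i : MvPowerSeries (Fin n) K) ∈
      (Ideal.span (s : Set (MvPowerSeries (Fin n) K))).radical) : False := by
  have hmem : RingHom.ker (killVars K n Finset.univ) ∈
      (Ideal.span (s : Set (MvPowerSeries (Fin n) K))).minimalPrimes := by
    refine ⟨⟨inferInstance, ?_⟩, ?_⟩
    · rw [Ideal.span_le]
      intro a ha
      refine (mem_ker_killVars _ _).2 fun m hm => ?_
      have : m = 0 := by
        ext i
        exact hm i (Finset.mem_univ _)
      rw [this]
      simpa using h0 a ha
    · rintro q ⟨hq, hq'⟩ -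
      refine (ker_killVars_le Finset.univ).trans ?_
      rw [Ideal.span_le]
      rintro _ ⟨i, rfl⟩
      exact (hq.radical_le_iff.2 hq') (hX i)
  have h1 := Ideal.height_le_card_of_mem_minimalPrimes_span_finset hmem
  have h2 := (card_le_height_killVars (K := K) (n := n) Finset.univ).trans h1
  rw [Finset.card_univ, Fintype.card_fin] at h2
  have : n ≤ s.card := by exact_mod_cast h2
  omega

lemma derivation_aeval {K A : Type*} [Field K] [CommRing A] [Algebra K A] {n : ℕ}
    (D : Derivation K A A) (y : Fin n → A) (p : MvPolynomial (Fin n) K) :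
    D (aeval y p) = ∑ i, aeval y (pderiv i p) * D (y i) := by
  induction p using MvPolynomial.induction_on with
  | C a => simp
  | add p q hp hq =>
    simp only [map_add, hp, hq, add_mul, Finset.sum_add_distrib]
  | mul_X p j hp =>
    have : ∀ i, aeval y (pderiv i (p * X j)) * D (y i) =
        y j * (aeval y (pderiv i p) * D (y i)) +
          (if i = j then aeval y p * D (y j) else 0) := by
      intro i
      rw [Derivation.leibniz, pderiv_X]
      by_cases h : i = j
      · subst h; simp; ring
      · simp [h, Ne.symm h]; ring
    simp only [this, Finset.sum_add_distrib, ← Finset.mul_sum, ← hp]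
    simp
    ring

lemma constantCoeff_aeval {K : Type*} [Field K] {n : ℕ} (y : Fin n → MvPowerSeries (Fin n) K)
    (hy : ∀ i, MvPowerSeries.constantCoeff (y i) = 0) (p : MvPolynomial (Fin n) K) :
    MvPowerSeries.constantCoeff (aeval y p) = eval (0 : Fin n → K) p := by
  induction p using MvPolynomial.induction_on with
  | C a => simp [MvPowerSeries.algebraMap_apply]
  | add p q hp hq => simp only [map_add, hp, hq]
  | mul_X p j hp => simp [hp, hy]

lemma aeval_X_coe {K : Type*} [Field K] {n : ℕ} (p : MvPolynomial (Fin n) K) :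
    aeval (MvPowerSeries.X : Fin n → MvPowerSeries (Fin n) K) p = (p : MvPowerSeries (Fin n) K) := by
  induction p using MvPolynomial.induction_on with
  | C a => simp [MvPowerSeries.algebraMap_apply]
  | add p q hp hq => simp only [map_add, hp, hq, MvPolynomial.coe_add]
  | mul_X p j hp => simp [hp]

lemma constantCoeff_coe' {K : Type*} [Field K] {n : ℕ} (p : MvPolynomial (Fin n) K) :
    MvPowerSeries.constantCoeff (p : MvPowerSeries (Fin n) K) = eval (0 : Fin n → K) p := by
  rw [← aeval_X_coe, constantCoeff_aeval _ (by simp)]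

lemma mk_aeval_of_iso {K : Type*} [Field K] {n : ℕ} (f g : MvPolynomial (Fin n) K)
    (ψ : (MvPowerSeries (Fin n) K ⧸ Ideal.span {(f : MvPowerSeries (Fin n) K)}) ≃ₐ[K]
      MvPowerSeries (Fin n) K ⧸ Ideal.span {(g : MvPowerSeries (Fin n) K)})
    (y : Fin n → MvPowerSeries (Fin n) K)
    (hy : ∀ i, ψ (Ideal.Quotient.mk _ (MvPowerSeries.X i)) = Ideal.Quotient.mk _ (y i))
    (p : MvPolynomial (Fin n) K) :
    ψ (Ideal.Quotient.mk _ (p : MvPowerSeries (Fin n) K)) =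
      Ideal.Quotient.mk _ (aeval y p) := by
  have h : ((ψ.toAlgHom.comp (Ideal.Quotient.mkₐ K
      (Ideal.span {(f : MvPowerSeries (Fin n) K)}))).comp
        (aeval (MvPowerSeries.X : Fin n → MvPowerSeries (Fin n) K))) =
      (Ideal.Quotient.mkₐ K (Ideal.span {(g : MvPowerSeries (Fin n) K)})).comp (aeval y) := by
    apply MvPolynomial.algHom_ext
    intro i
    simpa using hy i
  have := DFunLike.congr_fun h p
  rw [← aeval_X_coe p]
  exact this

lemma isUnit_of_isUnit_mk {K : Type*} [Field K] {n : ℕ} (g : MvPolynomial (Fin n) K)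
    (hg0 : eval (0 : Fin n → K) g = 0) (a : MvPowerSeries (Fin n) K)
    (ha : IsUnit (Ideal.Quotient.mk (Ideal.span {(g : MvPowerSeries (Fin n) K)}) a)) :
    MvPowerSeries.constantCoeff a ≠ 0 := by
  obtain ⟨b, hb⟩ := isUnit_iff_exists_inv.1 ha
  obtain ⟨b, rfl⟩ := Ideal.Quotient.mk_surjective b
  rw [← map_mul, ← map_one (Ideal.Quotient.mk _), Ideal.Quotient.eq,
    Ideal.mem_span_singleton] at hb
  obtain ⟨c, hc⟩ := hb
  have := congrArg MvPowerSeries.constantCoeff hc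
  rw [map_sub, map_mul, map_mul, constantCoeff_coe', hg0, map_one, zero_mul] at this
  intro h
  rw [h] at this
  simp at this

lemma isUnit_mk_iff {K : Type*} [Field K] {n : ℕ} (g : MvPolynomial (Fin n) K)
    (hg0 : eval (0 : Fin n → K) g = 0) (a : MvPowerSeries (Fin n) K) :
    IsUnit (Ideal.Quotient.mk (Ideal.span {(g : MvPowerSeries (Fin n) K)}) a) ↔
    MvPowerSeries.constantCoeff a ≠ 0 := by
  refine ⟨isUnit_of_isUnit_mk g hg0 a, fun h => ?_⟩
  apply IsUnit.map
  rw [MvPowerSeries.isUnit_iff_constantCoeff]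
  exact isUnit_iff_ne_zero.2 h

/-- Lifting the isomorphism to coordinates: the Jacobian matrix at the origin is invertible. -/
lemma exists_coords {K : Type*} [Field K] {n : ℕ} (f g : MvPolynomial (Fin n) K)
    (hf0 : eval (0 : Fin n → K) f = 0) (hg0 : eval (0 : Fin n → K) g = 0)
    (hg1 : ∀ i, eval (0 : Fin n → K) (pderiv i g) = 0)
    (ψ : (MvPowerSeries (Fin n) K ⧸ Ideal.span {(f : MvPowerSeries (Fin n) K)}) ≃ₐ[K]
      MvPowerSeries (Fin n) K ⧸ Ideal.span {(g : MvPowerSeries (Fin n) K)}) :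
    ∃ y : Fin n → MvPowerSeries (Fin n) K,
      (∀ i, ψ (Ideal.Quotient.mk _ (MvPowerSeries.X i)) = Ideal.Quotient.mk _ (y i)) ∧
      (∀ i, MvPowerSeries.constantCoeff (y i) = 0) ∧
      (∃ v, aeval y f = v * (g : MvPowerSeries (Fin n) K)) ∧
      (∀ k, (MvPowerSeries.X k : MvPowerSeries (Fin n) K) ∈
        Ideal.span (Set.range y) ⊔ Ideal.span {(g : MvPowerSeries (Fin n) K)}) ∧
      IsUnit (Matrix.of fun i j =>
        MvPowerSeries.constantCoeff (MvPowerSeries.pderiv K j (y i))) := by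
  classical
  choose y hy using fun i => Ideal.Quotient.mk_surjective
    (ψ (Ideal.Quotient.mk _ (MvPowerSeries.X i)))
  have hy0 : ∀ i, MvPowerSeries.constantCoeff (y i) = 0 := by
    intro i
    by_contra h
    rw [← ne_eq, ← isUnit_mk_iff g hg0, hy, MulEquiv.isUnit_map, isUnit_mk_iff f hf0] at h
    simp at h
  have hdec : ∀ k, ∃ (c : Fin n → MvPowerSeries (Fin n) K) (e : MvPowerSeries (Fin n) K),
      MvPowerSeries.X k = ∑ i, c i * y i + e * (g : MvPowerSeries (Fin n) K) := by
    intro k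
    obtain ⟨a, ha⟩ := Ideal.Quotient.mk_surjective (ψ.symm (Ideal.Quotient.mk _
      (MvPowerSeries.X k)))
    have ha0 : MvPowerSeries.constantCoeff a = 0 := by
      by_contra h
      rw [← ne_eq, ← isUnit_mk_iff f hf0, ha, MulEquiv.isUnit_map, isUnit_mk_iff g hg0] at h
      simp at h
    obtain ⟨c, hc⟩ := (Ideal.mem_span_range_iff_exists_fun).1 (mem_span_X_of_constantCoeff a ha0)
    choose b hb using fun i => Ideal.Quotient.mk_surjective (ψ (Ideal.Quotient.mk _ (c i)))
    have h1 : Ideal.Quotient.mk (Ideal.span {(g : MvPowerSeries (Fin n) K)})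
        (MvPowerSeries.X k) = Ideal.Quotient.mk _ (∑ i, b i * y i) := by
      rw [← ψ.apply_symm_apply (Ideal.Quotient.mk _ (MvPowerSeries.X k)), ← ha, ← hc]
      simp only [map_sum, map_mul, hb, hy]
    rw [Ideal.Quotient.eq, Ideal.mem_span_singleton'] at h1
    obtain ⟨e, he⟩ := h1
    exact ⟨b, e, by rw [he]; ring⟩
  refine ⟨y, fun i => (hy i).symm, hy0, ?_, ?_, ?_⟩
  · have h1 := mk_aeval_of_iso f g ψ y (fun i => (hy i).symm) f
    have h2 : Ideal.Quotient.mk (Ideal.span {(f : MvPowerSeries (Fin n) K)})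
        (f : MvPowerSeries (Fin n) K) = 0 :=
      Ideal.Quotient.eq_zero_iff_mem.2 (Ideal.mem_span_singleton_self _)
    rw [h2, map_zero] at h1
    obtain ⟨v, hv⟩ := Ideal.mem_span_singleton'.1 (Ideal.Quotient.eq_zero_iff_mem.1 h1.symm)
    exact ⟨v, hv.symm⟩
  · intro k
    obtain ⟨c, e, h⟩ := hdec k
    rw [h]
    refine Ideal.add_mem _ (Ideal.mem_sup_left (Ideal.sum_mem _ fun i _ =>
      Ideal.mul_mem_left _ _ (Ideal.subset_span ⟨i, rfl⟩))) (Ideal.mem_sup_right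
        (Ideal.mul_mem_left _ _ (Ideal.mem_span_singleton_self _)))
  · choose c e hce using hdec
    have hmul : (Matrix.of fun k i => MvPowerSeries.constantCoeff (c k i)) *
        (Matrix.of fun i j =>
          MvPowerSeries.constantCoeff (MvPowerSeries.pderiv K j (y i))) = 1 := by
      ext k j
      rw [Matrix.mul_apply, Matrix.one_apply]
      have h := congrArg (fun a => MvPowerSeries.constantCoeff (MvPowerSeries.pderiv K j a))
        (hce k)
      simp only [map_add, map_sum, Derivation.leibniz, smul_eq_mul, map_mul, hy0, zero_mul,
        add_zero, MvPowerSeries.pderiv_coe, constantCoeff_coe', hg0, hg1, mul_zero] at h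
      simp only [Matrix.of_apply]
      rw [← h]
      by_cases hkj : k = j
      · subst hkj; simp
      · rw [MvPowerSeries.pderiv_X_of_ne hkj]; simp [hkj]
    exact IsUnit.of_mul_eq_one _ (mul_eq_one_comm.1 hmul)

lemma X_mem_radical {K : Type*} [Field K] [IsAlgClosed K] {n : ℕ} (f : MvPolynomial (Fin n) K)
    (hiso : IsIsolatedCriticalAtZero f) (i : Fin n) :
    ∃ (N : ℕ) (c : Fin n → MvPowerSeries (Fin n) K),
      MvPowerSeries.X i ^ N = ∑ l, c l * (pderiv l f : MvPowerSeries (Fin n) K) := by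
  obtain ⟨-, u, hu, hV⟩ := hiso
  have h1 : u * X i ∈ (Ideal.span (Set.range fun l => pderiv l f)).radical := by
    rw [← MvPolynomial.vanishingIdeal_zeroLocus_eq_radical (K := K)]
    rw [MvPolynomial.mem_vanishingIdeal_iff]
    intro y hy
    rw [MvPolynomial.mem_zeroLocus_iff] at hy
    by_cases huy : eval y u = 0
    · simp [aeval_eq_eval, huy]
    · have : y = 0 := hV y huy fun l => by
        simpa [aeval_eq_eval] using hy _ (Ideal.subset_span ⟨l, rfl⟩)
      simp [this]
  obtain ⟨N, hN⟩ := h1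
  obtain ⟨c, hc⟩ := Ideal.mem_span_range_iff_exists_fun.1 hN
  have hunit : IsUnit ((u : MvPowerSeries (Fin n) K) ^ N) := by
    apply IsUnit.pow
    rw [MvPowerSeries.isUnit_iff_constantCoeff, constantCoeff_coe']
    exact isUnit_iff_ne_zero.2 hu
  obtain ⟨v, hv⟩ := isUnit_iff_exists_inv.1 hunit
  have h2 := congrArg (coeToMvPowerSeries.ringHom (σ := Fin n) (R := K)) hc
  simp only [map_sum, map_mul, map_pow, coeToMvPowerSeries.ringHom_apply, coe_X] at h2
  refine ⟨N, fun l => v * (c l : MvPowerSeries (Fin n) K), ?_⟩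
  simp only [mul_assoc, ← Finset.mul_sum, h2]
  rw [mul_pow, ← mul_assoc, mul_comm v, hv, one_mul]

/-- The core argument, once denominators are cleared. -/
lemma core_contradiction {K : Type*} [Field K] [IsAlgClosed K] {n : ℕ}
    (f g : MvPolynomial (Fin n) K) (hf0 : eval (0 : Fin n → K) f = 0)
    (hiso : IsIsolatedCriticalAtZero f)
    (d : ℕ) (hwh : IsWeightedHomogTD g d)
    (ψ : (MvPowerSeries (Fin n) K ⧸ Ideal.span {(f : MvPowerSeries (Fin n) K)}) ≃ₐ[K]
      MvPowerSeries (Fin n) K ⧸ Ideal.span {(g : MvPowerSeries (Fin n) K)})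
    (hd : 0 < ringChar K → ¬ (ringChar K ∣ d))
    (s : MvPolynomial (Fin n) K) (p : Fin n → MvPolynomial (Fin n) K)
    (hsp : s * f = ∑ i, p i * pderiv i f) (j : Fin n)
    (hj : eval (0 : Fin n → K) (p j) ≠ 0) : False := by
  classical
  have hf1 := hiso.1
  -- `g` vanishes at the origin
  have hg0 : eval (0 : Fin n → K) g = 0 := by
    by_contra h
    have h1 : IsUnit (g : MvPowerSeries (Fin n) K) := by
      rw [MvPowerSeries.isUnit_iff_constantCoeff, constantCoeff_coe']
      exact isUnit_iff_ne_zero.2 h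
    have h2 : Subsingleton
        (MvPowerSeries (Fin n) K ⧸ Ideal.span {(g : MvPowerSeries (Fin n) K)}) :=
      Ideal.Quotient.subsingleton_iff.2 (Ideal.span_singleton_eq_top.2 h1)
    have h3 : IsUnit (Ideal.Quotient.mk (Ideal.span {(f : MvPowerSeries (Fin n) K)}) 0) := by
      rw [← MulEquiv.isUnit_map ψ]
      exact isUnit_of_subsingleton _
    rw [isUnit_mk_iff f hf0] at h3
    simp at h3
  obtain ⟨z, hz, hz0, ⟨v, hv⟩, -, hzu⟩ := exists_coords g f hg0 hf0 hf1 ψ.symm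
  set Z := (Matrix.of fun i j =>
        MvPowerSeries.constantCoeff (MvPowerSeries.pderiv K j (z i))) with hZ
  have hg1 : ∀ i, eval (0 : Fin n → K) (pderiv i g) = 0 := by
    have h1 : Matrix.vecMul (fun i => eval (0 : Fin n → K) (pderiv i g)) Z = 0 := by
      ext k
      have h := congrArg (fun a => MvPowerSeries.constantCoeff (MvPowerSeries.pderiv K k a)) hv
      simp only [derivation_aeval, map_sum, map_add, Derivation.leibniz, smul_eq_mul, map_mul,
        MvPowerSeries.pderiv_coe, constantCoeff_coe', hf0, hf1, mul_zero, zero_mul, add_zero,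
        constantCoeff_aeval z hz0] at h
      simpa [Matrix.vecMul, dotProduct, hZ] using h
    have h2 := Matrix.vecMul_injective_of_isUnit hzu (h1.trans (Matrix.zero_vecMul Z).symm)
    exact fun i => congrFun h2 i
  obtain ⟨y, hy, hy0, ⟨w, hw⟩, hyX, hyu⟩ := exists_coords f g hf0 hg0 hg1 ψ
  obtain ⟨α, hα, -, hgα⟩ := hwh
  -- Euler's relation
  have hEuler : ∃ e : K, (g : MvPowerSeries (Fin n) K) =
      ∑ i, (MvPowerSeries.C (e * (α i : K)) * MvPowerSeries.X i) *
        (pderiv i g : MvPowerSeries (Fin n) K) := by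
    have hE := hgα.sum_weight_X_mul_pderiv
    by_cases hdK : (d : K) = 0
    · have hd0 : d = 0 := by
        have h1 := (ringChar.spec K d).1 hdK
        rcases Nat.eq_zero_or_pos (ringChar K) with h | h
        · rw [h] at h1
          exact Nat.eq_zero_of_zero_dvd h1
        · exact absurd h1 (hd h)
      have : g = 0 := by
        ext m
        rw [coeff_zero]
        by_contra hm
        have h1 := hgα hm
        rw [hd0] at h1
        have hm0 : m = 0 := by
          ext i
          by_contra hi
          have h2 := Finsupp.le_weight_of_ne_zero' (w := α) (s := i) (f := m) hi
          have := hα i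
          omega
        rw [hm0, ← MvPolynomial.constantCoeff_eq] at hm
        apply hm
        rw [← hg0, MvPolynomial.eval_zero]
      refine ⟨0, ?_⟩
      rw [this]
      simp
    · refine ⟨(d : K)⁻¹, ?_⟩
      have h2 := congrArg (coeToMvPowerSeries.ringHom (σ := Fin n) (R := K)) hE
      simp only [map_sum, map_mul, nsmul_eq_mul, map_natCast,
        coeToMvPowerSeries.ringHom_apply, coe_X] at h2
      have h3 : (MvPowerSeries.C ((d : K)⁻¹) : MvPowerSeries (Fin n) K) *
          (d : MvPowerSeries (Fin n) K) = 1 := by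
        rw [← map_natCast (MvPowerSeries.C (σ := Fin n) (R := K)), ← map_mul,
          inv_mul_cancel₀ hdK, map_one]
      calc (g : MvPowerSeries (Fin n) K) = MvPowerSeries.C ((d : K)⁻¹) *
            ((d : MvPowerSeries (Fin n) K) * (g : MvPowerSeries (Fin n) K)) := by rw [← mul_assoc, h3, one_mul]
        _ = _ := by
          rw [← h2, Finset.mul_sum]
          refine Finset.sum_congr rfl fun i _ => ?_
          rw [map_mul, map_natCast]
          ring
  obtain ⟨e, he⟩ := hEuler
  set J : Ideal (MvPowerSeries (Fin n) K) :=
    Ideal.span (Set.range fun i => (pderiv i g : MvPowerSeries (Fin n) K)) with hJ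
  have hJi : ∀ i, (pderiv i g : MvPowerSeries (Fin n) K) ∈ J := fun i =>
    Ideal.subset_span ⟨i, rfl⟩
  have hgJ : (g : MvPowerSeries (Fin n) K) ∈ J := by
    rw [he]
    exact Ideal.sum_mem _ fun i _ => Ideal.mul_mem_left _ _ (hJi i)
  have hgJ' : Ideal.span {(g : MvPowerSeries (Fin n) K)} ≤ J := by
    rw [Ideal.span_le]
    simpa using hgJ
  -- partial derivatives of `f` go into `J`
  have hF : ∀ l, aeval y (pderiv l f) ∈ J := by
    set P : Matrix (Fin n) (Fin n) (MvPowerSeries (Fin n) K) :=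
      Matrix.of fun i j => MvPowerSeries.pderiv K j (y i) with hP
    have hPu : IsUnit P.det := by
      rw [MvPowerSeries.isUnit_iff_constantCoeff, RingHom.map_det]
      exact (Matrix.isUnit_iff_isUnit_det _).1 hyu
    have h1 : ∀ k, Matrix.vecMul (fun l => aeval y (pderiv l f)) P k ∈ J := by
      intro k
      have h := congrArg (MvPowerSeries.pderiv K k) hw
      rw [derivation_aeval, Derivation.leibniz, MvPowerSeries.pderiv_coe] at h
      have h2 : Matrix.vecMul (fun l => aeval y (pderiv l f)) P k =
          w • (pderiv k g : MvPowerSeries (Fin n) K) +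
            (g : MvPowerSeries (Fin n) K) • MvPowerSeries.pderiv K k w := by
        rw [← h]
        simp [Matrix.vecMul, dotProduct, hP]
      rw [h2]
      exact Ideal.add_mem _ (Ideal.mul_mem_left _ _ (hJi k)) (Ideal.mul_mem_right _ _ hgJ)
    intro l
    have h2 : (fun l => aeval y (pderiv l f)) = Matrix.vecMul
        (Matrix.vecMul (fun l => aeval y (pderiv l f)) P) P⁻¹ := by
      rw [Matrix.vecMul_vecMul, Matrix.mul_nonsing_inv _ hPu, Matrix.vecMul_one]
    have h3 := congrFun h2 l
    rw [h3]
    change ∑ k, Matrix.vecMul (fun l => aeval y (pderiv l f)) P k * P⁻¹ k l ∈ J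
    exact Ideal.sum_mem _ fun k _ => Ideal.mul_mem_right _ _ (h1 k)
  -- the Jacobian ideal is primary to the maximal ideal
  have hyJ : ∀ i, y i ∈ J.radical := by
    intro i
    obtain ⟨N, c, hc⟩ := X_mem_radical f hiso i
    refine ⟨N, ?_⟩
    have h := congrArg (fun a => Ideal.Quotient.factor hgJ'
      (ψ (Ideal.Quotient.mk (Ideal.span {(f : MvPowerSeries (Fin n) K)}) a))) hc
    simp only [map_pow, map_sum, map_mul, hy, mk_aeval_of_iso f g ψ y hy,
      Ideal.Quotient.factor_mk] at h
    rw [Finset.sum_eq_zero (fun l _ => by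
      rw [Ideal.Quotient.eq_zero_iff_mem.2 (hF l), mul_zero]), ← map_pow] at h
    exact Ideal.Quotient.eq_zero_iff_mem.1 h
  have hXJ : ∀ k, (MvPowerSeries.X k : MvPowerSeries (Fin n) K) ∈ J.radical := by
    intro k
    refine (sup_le ?_ (hgJ'.trans Ideal.le_radical)) (hyX k)
    rw [Ideal.span_le]
    rintro _ ⟨i, rfl⟩
    exact hyJ i
  -- transport of the derivation
  set D : Derivation K (MvPowerSeries (Fin n) K) (MvPowerSeries (Fin n) K) :=
    ∑ i, (p i : MvPowerSeries (Fin n) K) • MvPowerSeries.pderiv K i with hD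
  have hDa : ∀ a, D a = ∑ i, (p i : MvPowerSeries (Fin n) K) * MvPowerSeries.pderiv K i a := by
    intro a
    rw [hD]
    have h1 := congrFun (map_sum (Derivation.coeFnAddMonoidHom (R := K)
      (A := MvPowerSeries (Fin n) K) (M := MvPowerSeries (Fin n) K))
      (fun i => (p i : MvPowerSeries (Fin n) K) • MvPowerSeries.pderiv K i) Finset.univ) a
    exact h1.trans (Finset.sum_apply _ _ _)
  have hDf : D (f : MvPowerSeries (Fin n) K) = (s : MvPowerSeries (Fin n) K) * f := by
    have h2 := congrArg (coeToMvPowerSeries.ringHom (σ := Fin n) (R := K)) hsp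
    simp only [map_sum, map_mul, coeToMvPowerSeries.ringHom_apply] at h2
    rw [hDa, h2]
    simp only [MvPowerSeries.pderiv_coe]
  choose b hb using fun i => Ideal.Quotient.mk_surjective
    (ψ (Ideal.Quotient.mk (Ideal.span {(f : MvPowerSeries (Fin n) K)}) (D (z i))))
  have hbg : ∃ c, ∑ i, b i * (pderiv i g : MvPowerSeries (Fin n) K) =
      c * (g : MvPowerSeries (Fin n) K) := by
    have h := congrArg D hv
    rw [derivation_aeval, Derivation.leibniz, hDf] at h
    have h0 : v • ((s : MvPowerSeries (Fin n) K) * f) + (f : MvPowerSeries (Fin n) K) • D v ∈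
        Ideal.span {(f : MvPowerSeries (Fin n) K)} := by
      have hf := Ideal.mem_span_singleton_self (f : MvPowerSeries (Fin n) K)
      exact Ideal.add_mem _ (Ideal.mul_mem_left _ _ (Ideal.mul_mem_left _ _ hf))
        (Ideal.mul_mem_right _ _ hf)
    rw [← h] at h0
    have h1 := congrArg ψ (Ideal.Quotient.eq_zero_iff_mem.2 h0)
    have h2 : ∀ q : MvPolynomial (Fin n) K,
        ψ (Ideal.Quotient.mk (Ideal.span {(f : MvPowerSeries (Fin n) K)}) (aeval z q)) =
          Ideal.Quotient.mk _ (q : MvPowerSeries (Fin n) K) := by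
      intro q
      rw [← mk_aeval_of_iso g f ψ.symm z hz q, AlgEquiv.apply_symm_apply]
    simp only [map_sum, map_mul, map_zero, h2, ← hb] at h1
    simp only [← map_mul, ← map_sum] at h1
    obtain ⟨c, hc⟩ := Ideal.mem_span_singleton'.1 (Ideal.Quotient.eq_zero_iff_mem.1 h1)
    refine ⟨c, ?_⟩
    rw [hc]
    exact Finset.sum_congr rfl fun i _ => mul_comm _ _
  obtain ⟨c, hc⟩ := hbg
  have hbu : ∃ k, MvPowerSeries.constantCoeff (b k) ≠ 0 := by
    by_contra! hcon
    have h1 : Matrix.mulVec Z (fun i => eval (0 : Fin n → K) (p i)) = 0 := by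
      ext k
      have h2 : MvPowerSeries.constantCoeff (D (z k)) = 0 := by
        by_contra h3
        rw [← ne_eq, ← isUnit_mk_iff f hf0, ← MulEquiv.isUnit_map ψ, ← hb,
          isUnit_mk_iff g hg0] at h3
        exact h3 (hcon k)
      rw [hDa] at h2
      simp only [map_sum, map_mul, constantCoeff_coe'] at h2
      rw [Pi.zero_apply, ← h2]
      simp [Matrix.mulVec, dotProduct, hZ, mul_comm]
    have h2 := Matrix.mulVec_injective_of_isUnit hzu (h1.trans (Matrix.mulVec_zero Z).symm)
    exact hj (congrFun h2 j)
  obtain ⟨k, hk⟩ := hbu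
  -- a syzygy with a unit coefficient
  set a : Fin n → MvPowerSeries (Fin n) K := fun i =>
    b i - c * (MvPowerSeries.C (e * (α i : K)) * MvPowerSeries.X i) with ha
  have hsyz : ∑ i, a i * (pderiv i g : MvPowerSeries (Fin n) K) = 0 := by
    simp only [ha, sub_mul, Finset.sum_sub_distrib, mul_assoc c, ← Finset.mul_sum]
    rw [← he, hc, sub_self]
  have hak : IsUnit (a k) := by
    rw [MvPowerSeries.isUnit_iff_constantCoeff]
    apply isUnit_iff_ne_zero.2
    simpa [ha] using hk
  set S : Finset (MvPowerSeries (Fin n) K) :=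
    (Finset.univ.erase k).image fun i => (pderiv i g : MvPowerSeries (Fin n) K) with hS
  have hSi : ∀ i, i ≠ k → (pderiv i g : MvPowerSeries (Fin n) K) ∈
      Ideal.span (S : Set (MvPowerSeries (Fin n) K)) := by
    intro i hi
    apply Ideal.subset_span
    rw [hS]
    exact Finset.mem_coe.2 (Finset.mem_image.2 ⟨i, by simp [hi], rfl⟩)
  have hJS : J ≤ Ideal.span (S : Set (MvPowerSeries (Fin n) K)) := by
    rw [hJ, Ideal.span_le]
    rintro _ ⟨i, rfl⟩
    by_cases hi : i = k
    · subst hi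
      rw [← Finset.add_sum_erase _ _ (Finset.mem_univ i)] at hsyz
      have h1 : a i * (pderiv i g : MvPowerSeries (Fin n) K) ∈
          Ideal.span (S : Set (MvPowerSeries (Fin n) K)) := by
        rw [eq_neg_of_add_eq_zero_left hsyz]
        refine Ideal.neg_mem_iff _ |>.2 (Ideal.sum_mem _ fun l hl => ?_)
        exact Ideal.mul_mem_left _ _ (hSi l (Finset.ne_of_mem_erase hl))
      exact (Ideal.unit_mul_mem_iff_mem _ hak).1 h1
    · exact hSi i hi
  refine no_small_primary S ?_ ?_ fun i => Ideal.radical_mono hJS (hXJ i)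
  · refine lt_of_le_of_lt Finset.card_image_le ?_
    rw [Finset.card_erase_of_mem (Finset.mem_univ _), Finset.card_univ, Fintype.card_fin]
    have := k.2
    omega
  · intro q hq
    obtain ⟨i, -, rfl⟩ := Finset.mem_image.1 hq
    rw [constantCoeff_coe', hg1]

/-- Lemma 2.5 (second assertion): under the same hypotheses, in every representation
`f = ∑ h_i ∂f/∂x_i` over the local ring at the origin, all the `h_i` lie in the
maximal ideal of that local ring. -/
theorem statement5 {K : Type*} [Field K] [IsAlgClosed K] {n : ℕ}
    (f : MvPolynomial (Fin n) K)
    (hf0 : eval (0 : Fin n → K) f = 0)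
    (hiso : IsIsolatedCriticalAtZero f)
    (d : ℕ) (hwh : WeightedHomogSing f d)
    (hd : 0 < ringChar K → ¬ (ringChar K ∣ d)) :
    ∀ h : Fin n → LocAt K (0 : Fin n → K),
      algebraMap (MvPolynomial (Fin n) K) (LocAt K (0 : Fin n → K)) f =
        ∑ i, h i * algebraMap (MvPolynomial (Fin n) K) (LocAt K (0 : Fin n → K)) (pderiv i f) →
      ∀ i, h i ∈ IsLocalRing.maximalIdeal (LocAt K (0 : Fin n → K)) := by
  intro h hh j
  by_contra hj
  obtain ⟨g, hg, ⟨ψ⟩⟩ := hwh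
  set M := RingHom.ker (eval (0 : Fin n → K) : MvPolynomial (Fin n) K →+* K) with hM
  obtain ⟨s, hs⟩ := IsLocalization.exist_integer_multiples_of_finite M.primeCompl h
  choose p hp using hs
  have hs0 : IsUnit (algebraMap (MvPolynomial (Fin n) K) (LocAt K (0 : Fin n → K)) s) :=
    IsLocalization.map_units _ s
  refine core_contradiction f g hf0 hiso d hg ψ hd s p ?_ j ?_
  · apply IsLocalization.injective (LocAt K (0 : Fin n → K)) M.primeCompl_le_nonZeroDivisors
    rw [map_mul, hh, map_sum, Finset.mul_sum]
    refine Finset.sum_congr rfl fun i _ => ?_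
    rw [map_mul, hp, Algebra.smul_def, mul_assoc]
  · intro h0
    apply hj
    have h1 : algebraMap (MvPolynomial (Fin n) K) (LocAt K (0 : Fin n → K)) (p j) ∈
        IsLocalRing.maximalIdeal (LocAt K (0 : Fin n → K)) :=
      (IsLocalization.AtPrime.to_map_mem_maximal_iff _ M (p j)).2 h0
    rw [hp, Algebra.smul_def] at h1
    exact (Ideal.unit_mul_mem_iff_mem _ hs0).1 h1

end
end

section
/- Let f ∈ K[x_1,…,x_n] with f(0) = 0, and suppose the origin is an isolated critical point of f. Then the quotient K[x_1,…,x_n]_m/(∂f/∂x_1,…,∂f/∂x_n) has Krull dimension 0 and is finite-dimensional as a K-vector space; moreover ∂f/∂x_1,…,∂f/∂x_n form a regular sequence in K[x_1,…,x_n]_m, and some power f^m of f lies in the ideal (∂f/∂x_1,…,∂f/∂x_n) of K[x_1,…,x_n]_m. -/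
open MvPolynomial

noncomputable section

section Helpers

/-- `x` is a nonzerodivisor modulo `I`. -/
def RegMod {R : Type*} [CommRing R] (x : R) (I : Ideal R) : Prop :=
  ∀ z, x * z ∈ I → z ∈ I

/-- There is a sequence of `d` elements of the maximal ideal, regular modulo `I`. -/
def DepthGE {R : Type*} [CommRing R] [IsLocalRing R] : ℕ → Ideal R → Prop
  | 0, _ => True
  | d + 1, I => ∃ x ∈ IsLocalRing.maximalIdeal R, RegMod x I ∧ DepthGE d (I ⊔ Ideal.span {x})

/-- The quotient by `I` has no socle. -/
def NoSocle {R : Type*} [CommRing R] [IsLocalRing R] (I : Ideal R) : Prop :=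
  ∀ w, (∀ a ∈ IsLocalRing.maximalIdeal R, a * w ∈ I) → w ∈ I

theorem mem_sup_singleton {R : Type*} [CommRing R] {I : Ideal R} {x z : R} :
    z ∈ I ⊔ Ideal.span {x} ↔ ∃ w, z - x * w ∈ I := by
  constructor
  · intro h
    obtain ⟨a, ha, b, hb, rfl⟩ := Submodule.mem_sup.1 h
    obtain ⟨w, rfl⟩ := Ideal.mem_span_singleton'.1 hb
    exact ⟨w, by convert ha using 1; ring⟩
  · rintro ⟨w, h⟩
    have : z = (z - x * w) + x * w := by ring
    rw [this]
    exact Submodule.add_mem_sup h (Ideal.mul_mem_right _ _ (Ideal.mem_span_singleton_self x))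

theorem ass_mem_iff {R : Type*} [CommRing R] (I : Ideal R) (a z : R) :
    a ∈ (⊥ : Submodule R (R ⧸ I)).colon {Ideal.Quotient.mk I z} ↔ a * z ∈ I := by
  rw [Submodule.mem_colon_singleton, Submodule.mem_bot, ← Ideal.Quotient.eq_zero_iff_mem]
  rfl

theorem exists_ass {R : Type*} [CommRing R] [IsNoetherianRing R] (I : Ideal R) (z : R)
    (hz : z ∉ I) : ∃ p : Ideal R, p ∈ associatedPrimes R (R ⧸ I) ∧ ∀ a, a * z ∈ I → a ∈ p := by
  obtain ⟨p, hp, h⟩ := exists_le_isAssociatedPrime_of_isNoetherianRing R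
    (Ideal.Quotient.mk I z) (by rwa [Ne, Ideal.Quotient.eq_zero_iff_mem])
  exact ⟨p, hp, fun a ha => h ((ass_mem_iff I a z).2 ha)⟩

theorem ass_spec {R : Type*} [CommRing R] [IsNoetherianRing R] {I p : Ideal R}
    (hp : p ∈ associatedPrimes R (R ⧸ I)) :
    p.IsPrime ∧ ∃ w, w ∉ I ∧ ∀ a, a ∈ p ↔ a * w ∈ I := by
  obtain ⟨h1, x, hx⟩ := isAssociatedPrime_iff.1 hp
  obtain ⟨w, rfl⟩ := Ideal.Quotient.mk_surjective x
  have key : ∀ a, a ∈ p ↔ a * w ∈ I := fun a => by rw [hx]; exact ass_mem_iff I a w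
  refine ⟨h1, w, fun hw => h1.ne_top ((Ideal.eq_top_iff_one _).2 ((key 1).2 (by simpa))), key⟩

theorem regMod_of_forall_ass {R : Type*} [CommRing R] [IsNoetherianRing R] {I : Ideal R} {x : R}
    (h : ∀ p ∈ associatedPrimes R (R ⧸ I), x ∉ p) : RegMod x I := by
  intro z hz
  by_contra hzI
  obtain ⟨p, hp, hp'⟩ := exists_ass I z hzI
  exact h p hp (hp' x hz)

theorem exists_common_reg {R : Type*} [CommRing R] [IsNoetherianRing R] [IsLocalRing R]
    {I J L : Ideal R} (hI : NoSocle I) (hJ : NoSocle J) (hL : NoSocle L) :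
    ∃ y ∈ IsLocalRing.maximalIdeal R, RegMod y I ∧ RegMod y J ∧ RegMod y L := by
  have aux : ∀ {I : Ideal R}, NoSocle I → ∀ p ∈ associatedPrimes R (R ⧸ I),
      ¬ IsLocalRing.maximalIdeal R ≤ p := by
    intro I hI p hp hle
    obtain ⟨_, w, hw, h⟩ := ass_spec hp
    exact hw (hI w fun a ha => (h a).1 (hle ha))
  set S : Set (Ideal R) := associatedPrimes R (R ⧸ I) ∪ associatedPrimes R (R ⧸ J) ∪
    associatedPrimes R (R ⧸ L) with hS
  have hfin : S.Finite :=
    ((associatedPrimes.finite R _).union (associatedPrimes.finite R _)).union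
      (associatedPrimes.finite R _)
  have hnot : ¬ ((IsLocalRing.maximalIdeal R : Set R) ⊆ ⋃ p ∈ S, ((id p : Ideal R) : Set R)) := by
    rw [Ideal.subset_union_prime_finite hfin (f := id) 0 0]
    · rintro ⟨p, (hp | hp) | hp, hle⟩
      · exact aux hI p hp hle
      · exact aux hJ p hp hle
      · exact aux hL p hp hle
    · rintro p ((hp | hp) | hp) _ _ <;> exact hp.isPrime
  obtain ⟨y, hy, hyS⟩ := Set.not_subset.1 hnot
  simp only [Set.mem_iUnion, not_exists] at hyS
  refine ⟨y, hy, ?_, ?_, ?_⟩ <;> refine regMod_of_forall_ass fun p hp hyp => hyS p ?_ hyp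
  · exact Or.inl (Or.inl hp)
  · exact Or.inl (Or.inr hp)
  · exact Or.inr hp

theorem DepthGE.noSocle {R : Type*} [CommRing R] [IsLocalRing R] {d : ℕ} {I : Ideal R}
    (h : DepthGE (d + 1) I) : NoSocle I := by
  obtain ⟨x, hx, hr, _⟩ := h
  exact fun w hw => hr w (hw x hx)

theorem regMod_swap {R : Type*} [CommRing R] {I : Ideal R} {x y : R} (hx : RegMod x I)
    (hy : RegMod y (I ⊔ Ideal.span {x})) : RegMod x (I ⊔ Ideal.span {y}) := by
  intro z hz
  obtain ⟨w, hw⟩ := mem_sup_singleton.1 hz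
  obtain ⟨v, hv⟩ := mem_sup_singleton.1
    (hy w (mem_sup_singleton.2 ⟨z, by convert I.neg_mem hw using 1; ring⟩))
  refine mem_sup_singleton.2 ⟨v, hx _ ?_⟩
  convert I.add_mem hw (I.mul_mem_left y hv) using 1; ring

theorem noSocle_exchange {R : Type*} [CommRing R] [IsLocalRing R] {I : Ideal R} {x f : R}
    (hxm : x ∈ IsLocalRing.maximalIdeal R) (hx : RegMod x I) (hf : RegMod f I)
    (h : NoSocle (I ⊔ Ideal.span {x})) : NoSocle (I ⊔ Ideal.span {f}) := by
  intro z hz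
  obtain ⟨w, hw⟩ := mem_sup_singleton.1 (hz x hxm)
  have : w ∈ I ⊔ Ideal.span {x} := by
    refine h w fun a ha => ?_
    obtain ⟨v, hv⟩ := mem_sup_singleton.1 (hz a ha)
    refine mem_sup_singleton.2 ⟨v, hf _ ?_⟩
    convert I.sub_mem (I.mul_mem_left x hv) (I.mul_mem_left a hw) using 1; ring
  obtain ⟨v, hv⟩ := mem_sup_singleton.1 this
  refine mem_sup_singleton.2 ⟨v, hx _ ?_⟩
  convert I.add_mem hw (I.mul_mem_left f hv) using 1; ring

theorem DepthGE.exchange {R : Type*} [CommRing R] [IsNoetherianRing R] [IsLocalRing R] {d : ℕ} :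
    ∀ {I : Ideal R} {f : R}, DepthGE (d + 1) I → f ∈ IsLocalRing.maximalIdeal R → RegMod f I →
      DepthGE d (I ⊔ Ideal.span {f}) := by
  induction d with
  | zero => intros; trivial
  | succ d ih =>
    intro I f hI hfm hf
    have hI' := hI
    obtain ⟨x, hxm, hx, hD⟩ := hI'
    obtain ⟨y, hym, h1, h2, h3⟩ := exists_common_reg hI.noSocle hD.noSocle
      (noSocle_exchange hxm hx hf hD.noSocle)
    have e1 : DepthGE (d + 1) (I ⊔ Ideal.span {y}) := by
      refine ⟨x, hxm, regMod_swap hx h2, ?_⟩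
      have := ih hD hym h2
      rwa [sup_right_comm] at this
    have e2 := ih e1 hfm (regMod_swap hf h3)
    rw [sup_right_comm] at e2
    exact ⟨y, hym, h3, e2⟩

theorem DepthGE.le_dim {R : Type*} [CommRing R] [IsNoetherianRing R] [IsLocalRing R] {d : ℕ} :
    ∀ {I p : Ideal R}, DepthGE d I → p ∈ associatedPrimes R (R ⧸ I) →
      (d : WithBot ℕ∞) ≤ ringKrullDim (R ⧸ p) := by
  induction d with
  | zero =>
    intro I p _ hp
    have := hp.isPrime
    exact_mod_cast ringKrullDim_nonneg_of_nontrivial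
  | succ d ih =>
    intro I p hI hp
    obtain ⟨x, hxm, hx, hD⟩ := hI
    obtain ⟨hprime, w, hw, hpw⟩ := ass_spec hp
    have hxp : x ∉ p := fun h => hw (hx w ((hpw x).1 h))
    obtain ⟨z, hzN, hz⟩ : ∃ z, (∀ a ∈ p, a * z ∈ I) ∧ z ∉ I ⊔ Ideal.span {x} := by
      by_contra! hcon
      let N : Ideal R :=
        { carrier := {z | ∀ a ∈ p, a * z ∈ I}
          add_mem' := fun {u v} hu hv a ha => by
            rw [mul_add]; exact I.add_mem (hu a ha) (hv a ha)
          zero_mem' := fun a _ => by simp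
          smul_mem' := fun c u hu a ha => by
            rw [smul_eq_mul, mul_left_comm]; exact I.mul_mem_left c (hu a ha) }
      have hN : N ≤ I := by
        refine Submodule.le_of_le_smul_of_le_jacobson_bot (I := Ideal.span {x})
          (IsNoetherian.noetherian N) ?_ ?_
        · rw [IsLocalRing.jacobson_eq_maximalIdeal ⊥ bot_ne_top, Ideal.span_singleton_le_iff_mem]
          exact hxm
        · intro z hz
          obtain ⟨v, hv⟩ := mem_sup_singleton.1 (hcon z hz)
          have hvN : v ∈ N := by
            intro a ha
            refine hx _ ?_
            convert I.sub_mem (hz a ha) (I.mul_mem_left a hv) using 1; ring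
          have : z = (z - x * v) + x • v := by simp
          rw [this]
          exact Submodule.add_mem_sup hv
            (Submodule.smul_mem_smul (Ideal.mem_span_singleton_self x) hvN)
      exact hw (hN fun a ha => (hpw a).1 ha)
    obtain ⟨q, hq, hzq⟩ := exists_ass _ z hz
    have hpq : p ≤ q := fun a ha => hzq a (Ideal.mem_sup_left (hzN a ha))
    have hxq : x ∈ q := hzq x (Ideal.mem_sup_right
      (Ideal.mul_mem_right _ _ (Ideal.mem_span_singleton_self x)))
    have h1 := ih hD hq
    have hnz : Ideal.Quotient.mk p x ∈ nonZeroDivisors (R ⧸ p) :=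
      mem_nonZeroDivisors_of_ne_zero (by rwa [Ne, Ideal.Quotient.eq_zero_iff_mem])
    have h2 := ringKrullDim_quotient_succ_le_of_nonZeroDivisor hnz
    have h3 : ringKrullDim (R ⧸ q) ≤
        ringKrullDim ((R ⧸ p) ⧸ Ideal.span {Ideal.Quotient.mk p x}) := by
      refine ringKrullDim_le_of_surjective
        (Ideal.Quotient.lift _ (Ideal.Quotient.factor hpq) ?_) ?_
      · intro a ha
        have : Ideal.span {Ideal.Quotient.mk p x} ≤ RingHom.ker (Ideal.Quotient.factor hpq) := by
          rw [Ideal.span_singleton_le_iff_mem, RingHom.mem_ker, Ideal.Quotient.factor_mk,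
            Ideal.Quotient.eq_zero_iff_mem]
          exact hxq
        exact this ha
      · exact Ideal.Quotient.lift_surjective_of_surjective _ _
          (Ideal.Quotient.factor_surjective hpq)
    calc ((d + 1 : ℕ) : WithBot ℕ∞) = (d : WithBot ℕ∞) + 1 := by push_cast; rfl
      _ ≤ ringKrullDim ((R ⧸ p) ⧸ Ideal.span {Ideal.Quotient.mk p x}) + 1 := by
          gcongr; exact h1.trans h3
      _ ≤ _ := h2

theorem dim_le_of_primary {R : Type*} [CommRing R] [IsNoetherianRing R] [IsLocalRing R]
    (p : Ideal R) [hp : p.IsPrime] (s : Finset R)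
    (hsm : ∀ x ∈ s, x ∈ IsLocalRing.maximalIdeal R)
    (hs : ∀ q : Ideal R, q.IsPrime → p ≤ q → (∀ x ∈ s, x ∈ q) → IsLocalRing.maximalIdeal R ≤ q) :
    ringKrullDim (R ⧸ p) ≤ s.card := by
  classical
  have : IsLocalRing (R ⧸ p) := .of_surjective' _ Ideal.Quotient.mk_surjective
  rw [← IsLocalRing.maximalIdeal_height_eq_ringKrullDim]
  have hcomap : (IsLocalRing.maximalIdeal (R ⧸ p)).comap (Ideal.Quotient.mk p) =
      IsLocalRing.maximalIdeal R :=
    IsLocalRing.eq_maximalIdeal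
      (Ideal.comap_isMaximal_of_surjective _ Ideal.Quotient.mk_surjective)
  have : (IsLocalRing.maximalIdeal (R ⧸ p)) ∈
      (Ideal.span ((s.image (Ideal.Quotient.mk p) : Finset _) : Set (R ⧸ p))).minimalPrimes := by
    refine ⟨⟨inferInstance, ?_⟩, ?_⟩
    · rw [Ideal.span_le]
      intro y hy
      simp only [Finset.coe_image, Set.mem_image] at hy
      obtain ⟨x, hx, rfl⟩ := hy
      have := hsm x hx
      rwa [← hcomap] at this
    · rintro q ⟨hq, hle⟩ _ y hy
      obtain ⟨x, rfl⟩ := Ideal.Quotient.mk_surjective y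
      have hx : x ∈ IsLocalRing.maximalIdeal R := by rw [← hcomap]; exact hy
      refine hs (q.comap (Ideal.Quotient.mk p)) inferInstance ?_ ?_ hx
      · intro a ha
        rw [Ideal.mem_comap, Ideal.Quotient.eq_zero_iff_mem.2 ha]
        exact q.zero_mem
      · intro a ha
        exact hle (Ideal.subset_span (by
          simp only [Finset.coe_image]; exact ⟨a, ha, rfl⟩))
  have h := Ideal.height_le_card_of_mem_minimalPrimes_span_finset this
  have h' : (IsLocalRing.maximalIdeal (R ⧸ p)).height ≤ (s.card : ℕ∞) :=
    h.trans (by exact_mod_cast Finset.card_image_le)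
  exact_mod_cast h'

theorem span_Iio_succ {R : Type*} [CommRing R] (F : ℕ → R) (i : ℕ) :
    Ideal.span (F '' Set.Iio (i + 1)) = Ideal.span (F '' Set.Iio i) ⊔ Ideal.span {F i} := by
  rw [← Ideal.span_union]
  congr 1
  ext y
  simp only [Set.mem_image, Set.mem_Iio, Set.mem_union, Set.mem_singleton_iff, Nat.lt_succ_iff_lt_or_eq]
  grind

theorem regMod_of_sop {R : Type*} [CommRing R] [IsNoetherianRing R] [IsLocalRing R] {n : ℕ}
    (hR : DepthGE n (⊥ : Ideal R)) (F : ℕ → R)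
    (hF : ∀ i < n, F i ∈ IsLocalRing.maximalIdeal R)
    (hrad : ∀ q : Ideal R, q.IsPrime → (∀ i < n, F i ∈ q) → IsLocalRing.maximalIdeal R ≤ q)
    (i : ℕ) (hi : i < n) : RegMod (F i) (Ideal.span (F '' Set.Iio i)) := by
  classical
  have step : ∀ i k, i + (k + 1) = n → DepthGE (k + 1) (Ideal.span (F '' Set.Iio i)) →
      RegMod (F i) (Ideal.span (F '' Set.Iio i)) := by
    intro i k hik hD
    refine regMod_of_forall_ass fun p hp hFp => ?_
    obtain ⟨hprime, w, _, hpw⟩ := ass_spec hp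
    have h1 := hD.le_dim hp
    have h2 := dim_le_of_primary p ((Finset.Ioo i n).image F) (by
      intro x hx
      obtain ⟨j, hj, rfl⟩ := Finset.mem_image.1 hx
      exact hF j (Finset.mem_Ioo.1 hj).2) (by
      intro q hq hpq hx
      refine hrad q hq fun j hj => ?_
      rcases lt_trichotomy j i with h | h | h
      · exact hpq ((hpw _).2 (Ideal.mul_mem_right _ _ (Ideal.subset_span ⟨j, h, rfl⟩)))
      · exact hpq (h ▸ hFp)
      · exact hx _ (Finset.mem_image_of_mem F (Finset.mem_Ioo.2 ⟨h, hj⟩)))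
    have h3 : ((Finset.Ioo i n).image F).card ≤ k :=
      Finset.card_image_le.trans (by simp; omega)
    have h4 : ((k + 1 : ℕ) : WithBot ℕ∞) ≤ (k : ℕ) := (h1.trans h2).trans (by exact_mod_cast h3)
    have h5 : k + 1 ≤ k := by exact_mod_cast h4
    omega
  have all : ∀ i k, i + k = n → DepthGE k (Ideal.span (F '' Set.Iio i)) := by
    intro i
    induction i with
    | zero =>
      intro k hk
      obtain rfl : k = n := by omega
      simpa using hR
    | succ i ih =>
      intro k hk
      have hD := ih (k + 1) (by omega)
      rw [span_Iio_succ]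
      exact hD.exchange (hF i (by omega)) (step i k (by omega) hD)
  obtain ⟨k, hk⟩ : ∃ k, i + (k + 1) = n := ⟨n - i - 1, by omega⟩
  exact step i k hk (all i _ hk)

theorem X_reg {K : Type*} [Field K] {σ : Type*} (s : Set σ) (i : σ) (hi : i ∉ s) :
    RegMod (X i : MvPolynomial σ K) (Ideal.span (X '' s)) := by
  classical
  intro z hz
  rw [mem_ideal_span_X_image] at hz ⊢
  intro m hm
  obtain ⟨j, hj, hmj⟩ := hz (Finsupp.single i 1 + m) (by
    rw [mem_support_iff, coeff_X_mul]; exact mem_support_iff.1 hm)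
  refine ⟨j, hj, ?_⟩
  have : i ≠ j := fun h => hi (h ▸ hj)
  simpa [Finsupp.single_apply, this] using hmj

theorem regMod_map {A B : Type*} [CommRing A] [CommRing B] [Algebra A B] (M : Submonoid A)
    [IsLocalization M B] {I : Ideal A} {x : A} (h : RegMod x I) :
    RegMod (algebraMap A B x) (I.map (algebraMap A B)) := by
  intro z hz
  obtain ⟨⟨a, s⟩, hs⟩ := IsLocalization.surj M z
  have h1 : algebraMap A B (x * a) ∈ I.map (algebraMap A B) := by
    rw [map_mul, ← hs, ← mul_assoc]
    exact Ideal.mul_mem_right _ _ hz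
  obtain ⟨c, hc, hca⟩ := (IsLocalization.algebraMap_mem_map_algebraMap_iff M B I _).1 h1
  have h2 : algebraMap A B a ∈ I.map (algebraMap A B) :=
    (IsLocalization.algebraMap_mem_map_algebraMap_iff M B I _).2
      ⟨c, hc, h _ (by convert hca using 1; ring)⟩
  rw [← hs] at h2
  exact (Ideal.mul_unit_mem_iff_mem _ (IsLocalization.map_units B s)).1 h2

theorem depth_locAt (K : Type*) [Field K] (n : ℕ) :
    DepthGE n (⊥ : Ideal (LocAt K (0 : Fin n → K))) := by
  have key : ∀ k i, i + k = n → DepthGE k ((Ideal.span (X '' {j : Fin n | j.1 < i}) :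
      Ideal (MvPolynomial (Fin n) K)).map (algebraMap _ (LocAt K (0 : Fin n → K)))) := by
    intro k
    induction k with
    | zero => intros; trivial
    | succ k ih =>
      intro i hi
      have hin : i < n := by omega
      refine ⟨algebraMap (MvPolynomial (Fin n) K) _ (X (⟨i, hin⟩ : Fin n)), ?_, ?_, ?_⟩
      · rw [← Localization.AtPrime.map_eq_maximalIdeal]
        exact Ideal.mem_map_of_mem _ (by simp [RingHom.mem_ker])
      · exact regMod_map (RingHom.ker (eval (0 : Fin n → K))).primeCompl
          (X_reg _ _ (by simp))
      · have := ih (i + 1) (by omega)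
        convert this using 1
        rw [← Set.image_singleton, ← Ideal.map_span, ← Ideal.map_sup, ← Ideal.span_union]
        congr 2
        ext y
        simp only [Set.mem_image, Set.mem_union, Set.mem_singleton_iff, Set.mem_ofPred_eq]
        constructor
        · rintro (⟨j, hj, rfl⟩ | rfl)
          · exact ⟨j, by omega, rfl⟩
          · exact ⟨⟨i, hin⟩, by simp, rfl⟩
        · rintro ⟨j, hj, rfl⟩
          rcases Nat.lt_succ_iff_lt_or_eq.1 hj with h | h
          · exact Or.inl ⟨j, h, rfl⟩
          · exact Or.inr (congrArg X (Fin.ext h))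
  have := key n 0 (by omega)
  simpa using this

theorem maximal_le_of_prime {K : Type*} [Field K] {n : ℕ}
    (q : Ideal (LocAt K (0 : Fin n → K)))
    (hX : ∀ i, algebraMap (MvPolynomial (Fin n) K) (LocAt K (0 : Fin n → K)) (X i) ∈ q) :
    IsLocalRing.maximalIdeal (LocAt K (0 : Fin n → K)) ≤ q := by
  rw [← Localization.AtPrime.map_eq_maximalIdeal, Ideal.map_le_iff_le_comap]
  have h : Ideal.span (Set.range (X : Fin n → MvPolynomial (Fin n) K)) ≤
      q.comap (algebraMap _ _) := by
    rw [Ideal.span_le]; rintro _ ⟨i, rfl⟩; exact hX i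
  refine le_trans ?_ h
  intro p hp
  rw [← Set.image_univ, mem_ideal_span_X_image]
  intro m hm
  by_contra! hcon
  have hm0 : m = 0 := by ext i; simpa using hcon i
  subst hm0
  rw [RingHom.mem_ker, MvPolynomial.eval_zero, constantCoeff_eq] at hp
  exact (mem_support_iff.1 hm) hp

theorem exists_pow_X {K : Type*} [Field K] [IsAlgClosed K] {n : ℕ}
    (f : MvPolynomial (Fin n) K) (hiso : IsIsolatedCriticalAtZero f) (i : Fin n) :
    ∃ k, algebraMap (MvPolynomial (Fin n) K) (LocAt K (0 : Fin n → K)) (X i) ^ k ∈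
        Ideal.span (Set.range fun i =>
          algebraMap (MvPolynomial (Fin n) K) (LocAt K (0 : Fin n → K)) (pderiv i f)) := by
  obtain ⟨_, u, hu0, hu⟩ := hiso
  have h1 : X i * u ∈ (Ideal.span (Set.range fun i => pderiv i f)).radical := by
    rw [← vanishingIdeal_zeroLocus_eq_radical (K := K), mem_vanishingIdeal_iff]
    intro y hy
    have hy' : ∀ j, eval y (pderiv j f) = 0 := fun j => by
      have := (mem_zeroLocus_iff.1 hy) (pderiv j f) (Ideal.subset_span ⟨j, rfl⟩)
      simpa [aeval_eq_eval] using this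
    rw [map_mul]
    by_cases hyu : eval y u = 0
    · simp [aeval_eq_eval, hyu]
    · simp [hu y hyu hy']
  obtain ⟨k, hk⟩ := h1
  refine ⟨k, ?_⟩
  have h2 := Ideal.mem_map_of_mem (algebraMap _ (LocAt K (0 : Fin n → K))) hk
  rw [Ideal.map_span, ← Set.range_comp, mul_pow, map_mul, map_pow] at h2
  have hunit : IsUnit (algebraMap (MvPolynomial (Fin n) K) (LocAt K (0 : Fin n → K)) (u ^ k)) := by
    rw [map_pow]
    exact (IsLocalization.map_units (LocAt K (0 : Fin n → K))
      (⟨u, hu0⟩ : (RingHom.ker (eval (0 : Fin n → K))).primeCompl)).pow k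
  exact (Ideal.mul_unit_mem_iff_mem _ hunit).1 h2

theorem quot_surj {K : Type*} [Field K] {n : ℕ} (J : Ideal (LocAt K (0 : Fin n → K)))
    (hJ : IsLocalRing.maximalIdeal (LocAt K (0 : Fin n → K)) ≤ J.radical) :
    Function.Surjective (Algebra.ofId (MvPolynomial (Fin n) K)
      (LocAt K (0 : Fin n → K) ⧸ J)) := by
  intro y
  obtain ⟨z, rfl⟩ := Ideal.Quotient.mk_surjective y
  obtain ⟨⟨a, s⟩, hs⟩ :=
    IsLocalization.surj (RingHom.ker (eval (0 : Fin n → K))).primeCompl z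
  -- find an inverse of `s` modulo `J`
  set φ := Algebra.ofId (MvPolynomial (Fin n) K) (LocAt K (0 : Fin n → K) ⧸ J) with hφ
  have hφ' : ∀ p, φ p = Ideal.Quotient.mk J (algebraMap _ _ p) := fun p => rfl
  set c : K := eval (0 : Fin n → K) s.1 with hc
  have hc0 : c ≠ 0 := s.2
  let t : MvPolynomial (Fin n) K := 1 - C c⁻¹ * s.1
  have ht : t ∈ RingHom.ker (eval (0 : Fin n → K)) := by
    rw [RingHom.mem_ker, map_sub, map_one, map_mul, eval_C, ← hc, inv_mul_cancel₀ hc0, sub_self]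
  have htm : algebraMap _ (LocAt K (0 : Fin n → K)) t ∈ J.radical := hJ (by
    rw [← Localization.AtPrime.map_eq_maximalIdeal]
    exact Ideal.mem_map_of_mem _ ht)
  obtain ⟨k, hk⟩ := htm
  have htk : φ t ^ k = 0 := by
    rw [hφ', ← map_pow, Ideal.Quotient.eq_zero_iff_mem]; exact hk
  refine ⟨a * (C c⁻¹ * ∑ i ∈ Finset.range k, t ^ i), ?_⟩
  have hs' : φ a = Ideal.Quotient.mk J z * φ s.1 := by
    rw [hφ', hφ', ← map_mul, hs]
  have hinv : φ s.1 * φ (C c⁻¹ * ∑ i ∈ Finset.range k, t ^ i) = 1 := by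
    rw [← map_mul]
    have : s.1 * (C c⁻¹ * ∑ i ∈ Finset.range k, t ^ i) = 1 - t ^ k := by
      rw [← mul_neg_geom_sum]; simp only [t]; ring
    rw [this, map_sub, map_pow, htk, map_one, sub_zero]
  rw [map_mul, hs', mul_assoc, hinv, mul_one]

theorem artin_dim (A : Type*) [CommRing A] [IsArtinianRing A] [Nontrivial A] :
    ringKrullDim A = 0 :=
  ringKrullDimZero_iff_ringKrullDim_eq_zero.1
    ((isArtinianRing_iff_isNoetherianRing_krullDimLE_zero.1 inferInstance).2)

end Helpers

/-- If the origin is an isolated critical point of `f` (with `f(0) = 0`), then the quotient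
of the local ring at the origin by the ideal of partial derivatives has Krull dimension `0`
and is finite-dimensional over `K`; the partial derivatives form a regular sequence in the
local ring; and some positive power of `f` lies in the ideal they generate. -/
theorem statement6 {K : Type*} [Field K] [IsAlgClosed K] {n : ℕ}
    (f : MvPolynomial (Fin n) K)
    (hf0 : eval (0 : Fin n → K) f = 0)
    (hiso : IsIsolatedCriticalAtZero f) :
    ringKrullDim ((LocAt K (0 : Fin n → K)) ⧸
        Ideal.span (Set.range fun i =>
          algebraMap (MvPolynomial (Fin n) K) (LocAt K (0 : Fin n → K)) (pderiv i f))) = 0 ∧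
    FiniteDimensional K ((LocAt K (0 : Fin n → K)) ⧸
        Ideal.span (Set.range fun i =>
          algebraMap (MvPolynomial (Fin n) K) (LocAt K (0 : Fin n → K)) (pderiv i f))) ∧
    IsRegSeq (List.ofFn fun i : Fin n =>
        algebraMap (MvPolynomial (Fin n) K) (LocAt K (0 : Fin n → K)) (pderiv i f)) ∧
    ∃ k : ℕ, 0 < k ∧
      algebraMap (MvPolynomial (Fin n) K) (LocAt K (0 : Fin n → K)) (f ^ k) ∈
        Ideal.span (Set.range fun i =>
          algebraMap (MvPolynomial (Fin n) K) (LocAt K (0 : Fin n → K)) (pderiv i f)) := by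
  classical
  set R := LocAt K (0 : Fin n → K) with hR
  set J : Ideal R := Ideal.span (Set.range fun i =>
          algebraMap (MvPolynomial (Fin n) K) (LocAt K (0 : Fin n → K)) (pderiv i f)) with hJdef
  have hnoeth : IsNoetherianRing R :=
    IsLocalization.isNoetherianRing (RingHom.ker (eval (0 : Fin n → K))).primeCompl R inferInstance
  have hmem : ∀ p : MvPolynomial (Fin n) K, eval (0 : Fin n → K) p = 0 →
      algebraMap _ R p ∈ IsLocalRing.maximalIdeal R := fun p hp => by
    rw [← Localization.AtPrime.map_eq_maximalIdeal]
    exact Ideal.mem_map_of_mem _ (by rwa [RingHom.mem_ker])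
  have hJm : J ≤ IsLocalRing.maximalIdeal R := by
    rw [hJdef, Ideal.span_le]
    rintro _ ⟨i, rfl⟩
    exact hmem _ (hiso.1 i)
  have hrad : ∀ q : Ideal R, q.IsPrime → J ≤ q → IsLocalRing.maximalIdeal R ≤ q := by
    intro q hq hJq
    refine maximal_le_of_prime q fun i => ?_
    obtain ⟨k, hk⟩ := exists_pow_X f hiso i
    exact hq.mem_of_pow_mem k (hJq hk)
  have hJrad : IsLocalRing.maximalIdeal R ≤ J.radical := by
    rw [Ideal.radical_eq_sInf]
    exact le_sInf fun q hq => hrad q hq.2 hq.1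
  have hart : IsArtinianRing (R ⧸ J) :=
    IsLocalRing.quotient_artinian_of_mem_minimalPrimes_of_isLocalRing J
      ⟨⟨inferInstance, hJm⟩, fun q hq _ => hrad q hq.1 hq.2⟩
  have hnt : Nontrivial (R ⧸ J) := Ideal.Quotient.nontrivial_iff.2 fun h =>
    (IsLocalRing.maximalIdeal.isMaximal R).ne_top (top_le_iff.1 (h ▸ hJm))
  refine ⟨?_, ?_, ?_, ?_⟩
  · exact artin_dim (R ⧸ J)
  · have hft : Algebra.FiniteType K (R ⧸ J) :=
      Algebra.FiniteType.of_surjective ((Algebra.ofId (MvPolynomial (Fin n) K)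
        (R ⧸ J)).restrictScalars K) (quot_surj J hJrad)
    exact (Module.finite_iff_isArtinianRing K (R ⧸ J)).2 hart
  · set F : ℕ → R := fun i => if h : i < n then algebraMap _ R (pderiv ⟨i, h⟩ f) else 0 with hF
    have hFi : ∀ i (h : i < n), F i = algebraMap _ R (pderiv ⟨i, h⟩ f) := fun i h => by
      simp [hF, h]
    intro i hi x hx
    have hin : i < n := by simpa using hi
    have hset : {y | ∃ (j : ℕ) (hj : j < i), y = (List.ofFn fun i : Fin n =>
        algebraMap (MvPolynomial (Fin n) K) (LocAt K (0 : Fin n → K)) (pderiv i f))[j]'(hj.trans hi)}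
        = F '' Set.Iio i := by
      ext y
      simp only [Set.mem_ofPred_eq, Set.mem_image, Set.mem_Iio, List.getElem_ofFn]
      constructor
      · rintro ⟨j, hj, rfl⟩
        exact ⟨j, hj, hFi j (hj.trans hin)⟩
      · rintro ⟨j, hj, rfl⟩
        exact ⟨j, hj, hFi j (hj.trans hin)⟩
    rw [hset] at hx ⊢
    rw [List.getElem_ofFn] at hx
    refine regMod_of_sop (depth_locAt K n) F ?_ ?_ i hin x ?_
    · intro j hj
      rw [hFi j hj]; exact hmem _ (hiso.1 _)
    · intro q hq hFq
      refine hrad q hq ?_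
      rw [hJdef, Ideal.span_le]
      rintro _ ⟨j, rfl⟩
      have := hFq j.1 j.2
      rwa [hFi j.1 j.2] at this
    · rw [hFi i hin]; exact hx
  · obtain ⟨k, hk⟩ := hJrad (hmem f hf0)
    refine ⟨k + 1, Nat.succ_pos k, ?_⟩
    rw [map_pow, pow_succ]
    exact Ideal.mul_mem_right _ _ hk

end
end

section
/- Assume Hypothesis (A), that no singular point of the hypersurface f^(δ) = 0 in P^{n−1} lies on the hyperplane x_n = 0, and that f^(δ)(x_1,…,x_{n−1},0) = 0 defines a smooth hypersurface in P^{n−2}. Let ω_1,…,ω_n and ξ_1,…,ξ_n be homogeneous polynomials in K[x_1,…,x_n] satisfying Σ_{i=1}^n (∂f^(δ)/∂x_i) ω_i = 0 and Σ_{i=1}^n (∂f^(δ')/∂x_i) ω_i = Σ_{i=1}^n (∂f^(δ)/∂x_i) ξ_i. Then there exists a homogeneous polynomial P ∈ K[x_1,…,x_n] such that P ω_n lies in the ideal (∂f^(δ)/∂x_1,…,∂f^(δ)/∂x_{n−1}) of K[x_1,…,x_n] and P does not vanish at any singular point of the hypersurface f^(δ) = 0 in P^{n−1}. -/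
open MvPolynomial

noncomputable section

section
open Ideal
def RegL {R : Type*} [CommRing R] : Ideal R → List R → Prop
  | _, [] => True
  | I, x :: l => (∀ z, x * z ∈ I → z ∈ I) ∧ RegL (I ⊔ span {x}) l

section
variable {R : Type*} [CommRing R]

lemma mem_sup_span {I : Ideal R} {x z : R} : z ∈ I ⊔ span {x} ↔ ∃ i ∈ I, ∃ c, z = i + x * c := by
  rw [Submodule.mem_sup]
  constructor
  · rintro ⟨i, hi, y, hy, rfl⟩
    obtain ⟨c, rfl⟩ := Ideal.mem_span_singleton'.1 hy
    exact ⟨i, hi, c, by ring⟩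
  · rintro ⟨i, hi, c, rfl⟩
    exact ⟨i, hi, _, Ideal.mem_span_singleton'.2 ⟨c, rfl⟩, by ring⟩

lemma regL_swap [IsLocalRing R] [IsNoetherianRing R] {I : Ideal R} {a b : R} {l : List R}
    (ha : a ∈ IsLocalRing.maximalIdeal R) (h : RegL I (a :: b :: l)) : RegL I (b :: a :: l) := by
  obtain ⟨h1, h2, h3⟩ := h
  have key : ∀ z, b * z ∈ I → z ∈ I := by
    let N : Ideal R := Submodule.comap (LinearMap.mulLeft R b) I
    have hN : ∀ z, z ∈ N ↔ b * z ∈ I := fun z => Iff.rfl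
    have : N ≤ I := by
      refine Submodule.le_of_le_smul_of_le_jacobson_bot (I := IsLocalRing.maximalIdeal R)
        (IsNoetherian.noetherian N) (IsLocalRing.maximalIdeal_le_jacobson _) ?_
      intro z hz
      obtain ⟨i, hi, c, rfl⟩ := mem_sup_span.1 (h2 z (mem_sup_left ((hN _).1 hz)))
      refine Submodule.add_mem_sup hi ?_
      refine Submodule.smul_mem_smul ha ?_
      rw [hN]
      apply h1
      have := (hN _).1 hz
      have h' := I.sub_mem this (I.mul_mem_left b hi)
      convert h' using 1; ring
    exact fun z hz => this hz
  refine ⟨key, ?_, ?_⟩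
  · intro z hz
    obtain ⟨i, hi, s, hs⟩ := mem_sup_span.1 hz
    have : b * s ∈ I ⊔ span {a} := by
      rw [mem_sup_span]
      exact ⟨-i, I.neg_mem hi, z, by linear_combination -hs⟩
    obtain ⟨i', hi', s', hs'⟩ := mem_sup_span.1 (h2 _ this)
    rw [mem_sup_span]
    refine ⟨z - b * s', ?_, s', by ring⟩
    apply h1
    have := I.add_mem hi (I.mul_mem_left b hi')
    convert this using 1
    subst hs'
    linear_combination hs
  · rwa [sup_assoc, sup_comm (span {b}), ← sup_assoc]

lemma regL_toEnd [IsLocalRing R] [IsNoetherianRing R] {a : R}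
    (ha : a ∈ IsLocalRing.maximalIdeal R) (l : List R) : ∀ {I : Ideal R},
    RegL I (a :: l) → RegL I (l ++ [a]) := by
  induction l with
  | nil => intro I h; exact h
  | cons b l ih =>
    intro I h
    have := regL_swap ha h
    exact ⟨this.1, ih this.2⟩

lemma regL_toFront [IsLocalRing R] [IsNoetherianRing R] {a : R} (l : List R) : ∀ {I : Ideal R},
    (∀ x ∈ l, x ∈ IsLocalRing.maximalIdeal R) →
    RegL I (l ++ [a]) → RegL I (a :: l) := by
  induction l with
  | nil => intro I _ h; exact h
  | cons b l ih =>
    intro I hl h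
    exact regL_swap (hl b (by simp)) ⟨h.1, ih (fun x hx => hl x (by simp [hx])) h.2⟩

lemma regL_exchange {a b : R} {k : ℕ} (l : List R) : ∀ {I : Ideal R},
    RegL I (l ++ [a]) → a ^ k ∈ I ⊔ ofList l ⊔ span {b} → RegL I (l ++ [b]) := by
  induction l with
  | nil =>
    intro I h hk
    refine ⟨fun z hz => ?_, trivial⟩
    have h1 : ∀ k z, a ^ k * z ∈ I → z ∈ I := by
      intro k
      induction k with
      | zero => intro z hz; simpa using hz
      | succ k ih => intro z hz; exact ih _ (h.1 _ (by convert hz using 1; ring))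
    apply h1 k
    simp only [ofList_nil, sup_bot_eq] at hk
    obtain ⟨i, hi, c, hc⟩ := mem_sup_span.1 hk
    rw [hc]
    have := I.add_mem (I.mul_mem_left z hi) (I.mul_mem_left c hz)
    convert this using 1; ring
  | cons x l ih =>
    intro I h hk
    exact ⟨h.1, ih h.2 (by simpa [ofList_cons, sup_assoc] using hk)⟩

open IsLocalRing in
lemma exists_common [IsLocalRing R] [IsNoetherianRing R] (r : ℕ) : ∀ (A B : Ideal R),
    (∀ q : PrimeSpectrum R, A ≤ q.asIdeal → Order.coheight q ≤ r) →
    (∀ q : PrimeSpectrum R, B ≤ q.asIdeal → Order.coheight q ≤ r) →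
    ∃ w : List R, w.length = r ∧ (∀ x ∈ w, x ∈ maximalIdeal R) ∧
      maximalIdeal R ≤ (A ⊔ ofList w).radical ∧ maximalIdeal R ≤ (B ⊔ ofList w).radical := by
  induction r with
  | zero =>
    intro A B hA hB
    have main : ∀ A : Ideal R, (∀ q : PrimeSpectrum R, A ≤ q.asIdeal → Order.coheight q ≤ (0:ℕ)) →
        maximalIdeal R ≤ A.radical := by
      intro A hA
      rw [Ideal.radical_eq_sInf]
      refine le_sInf ?_
      rintro q ⟨hq, hp⟩
      have := hA ⟨q, hp⟩ hq
      have h0 : Order.coheight (⟨q, hp⟩ : PrimeSpectrum R) = 0 := by simpa using this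
      rw [Order.coheight_eq_zero] at h0
      exact h0 (b := closedPoint R) (IsLocalRing.le_maximalIdeal hp.ne_top)
    exact ⟨[], rfl, by simp, by simpa using main A hA, by simpa using main B hB⟩
  | succ r ih =>
    intro A B hA hB
    let s : Set (Ideal R) := (A.minimalPrimes ∪ B.minimalPrimes) \ {maximalIdeal R}
    have hs : s.Finite := ((finite_minimalPrimes_of_isNoetherianRing R A).union
      (finite_minimalPrimes_of_isNoetherianRing R B)).sdiff
    have hsp : ∀ q ∈ s, q.IsPrime := by
      rintro q ⟨h | h, -⟩
      · exact h.1.1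
      · exact h.1.1
    obtain ⟨w, hw, hws⟩ : ∃ w ∈ maximalIdeal R, ∀ q ∈ s, w ∉ q := by
      by_contra! hcon
      have h1 : ((maximalIdeal R : Ideal R) : Set R) ⊆ ⋃ q ∈ (hs.toFinset : Set (Ideal R)), (q : Set R) := by
        intro w hw
        obtain ⟨q, hq, hwq⟩ := hcon w hw
        simp only [Set.mem_iUnion]
        exact ⟨q, by simpa using hq, hwq⟩
      rw [Ideal.subset_union_prime (f := fun q => q) ⊤ ⊤
        (fun q hq _ _ => hsp q (by simpa using hq))] at h1
      obtain ⟨q, hq, hle⟩ := h1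
      have hq' : q ∈ s := by simpa using hq
      exact hq'.2 (le_antisymm (IsLocalRing.le_maximalIdeal (hsp q hq').ne_top) hle)
    have main : ∀ A : Ideal R, A.minimalPrimes \ {maximalIdeal R} ⊆ s →
        (∀ q : PrimeSpectrum R, A ≤ q.asIdeal → Order.coheight q ≤ (r+1:ℕ)) →
        ∀ q : PrimeSpectrum R, A ⊔ span {w} ≤ q.asIdeal → Order.coheight q ≤ r := by
      intro A hAs hA q hq
      obtain ⟨q0, hq0, hle⟩ := Ideal.exists_minimalPrimes_le (le_sup_left.trans hq)
      have := hq0.1.1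
      by_cases hm : q0 = maximalIdeal R
      · have hqm : IsMax q := by
          intro q' hq'
          exact (IsLocalRing.le_maximalIdeal q'.2.ne_top).trans (hm ▸ hle)
        rw [Order.coheight_eq_zero.2 hqm]; simp
      · have hlt : (⟨q0, this⟩ : PrimeSpectrum R) < q := by
          refine lt_of_le_of_ne hle ?_
          rintro rfl
          exact hws q0 (hAs ⟨hq0, hm⟩) (hq (mem_sup_right (Ideal.mem_span_singleton_self w)))
        have h1 := Order.coheight_add_one_le hlt
        have h2 := h1.trans (hA ⟨q0, this⟩ hq0.1.2)
        push_cast at h2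
        exact (ENat.add_le_add_iff_right (by simp)).1 h2
    obtain ⟨l, hl, hlm, h1, h2⟩ := ih (A ⊔ span {w}) (B ⊔ span {w})
      (main A (by intro q hq; exact ⟨Or.inl hq.1, hq.2⟩) hA)
      (main B (by intro q hq; exact ⟨Or.inr hq.1, hq.2⟩) hB)
    refine ⟨w :: l, by simp [hl], by simpa using ⟨hw, hlm⟩, ?_, ?_⟩
    · simpa [ofList_cons, sup_assoc] using h1
    · simpa [ofList_cons, sup_assoc] using h2

open IsLocalRing in
lemma coheight_le_of_list [IsLocalRing R] [IsNoetherianRing R] (l : List R) (A : Ideal R)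
    (hlm : ∀ x ∈ l, x ∈ maximalIdeal R) (hm : maximalIdeal R ≤ (A ⊔ ofList l).radical)
    (q : PrimeSpectrum R) (hq : A ≤ q.asIdeal) : Order.coheight q ≤ l.length := by
  classical
  have h0 : ringKrullDim (R ⧸ q.asIdeal) = Order.coheight q := by
    rw [ringKrullDim_quotient]
    rw [Order.coheight_eq_krullDim_Ici]
    have : PrimeSpectrum.zeroLocus (R := R) q.asIdeal = Set.Ici q := by
      ext p; exact Iff.rfl
    rw [this]
  have hl : IsLocalRing (R ⧸ q.asIdeal) :=
    IsLocalRing.of_surjective' (Ideal.Quotient.mk q.asIdeal) Ideal.Quotient.mk_surjective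
  have hmem : ∀ x ∈ l, x ∈ maximalIdeal R := hlm
  have h1 : (maximalIdeal (R ⧸ q.asIdeal)) ∈
      (Ideal.span (((l.map (Ideal.Quotient.mk q.asIdeal)).toFinset : Finset _) : Set (R ⧸ q.asIdeal))).minimalPrimes := by
    have hloc : IsLocalHom (Ideal.Quotient.mk q.asIdeal) :=
      IsLocalHom.of_surjective _ Ideal.Quotient.mk_surjective
    refine ⟨⟨inferInstance, ?_⟩, ?_⟩
    · rw [Ideal.span_le]
      intro y hy
      simp only [List.coe_toFinset, List.mem_map, Set.mem_ofPred_eq] at hy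
      obtain ⟨x, hx, rfl⟩ := hy
      exact (map_mem_nonunits_iff _ _).2 (hmem x hx)
    · rintro p ⟨hp, hle⟩ -
      have h5 : A ⊔ ofList l ≤ p.comap (Ideal.Quotient.mk q.asIdeal) := by
        refine sup_le ?_ ?_
        · intro x hx
          rw [Ideal.mem_comap, Ideal.Quotient.eq_zero_iff_mem.2 (hq hx)]
          exact p.zero_mem
        · refine Ideal.span_le.2 ?_
          intro x hx
          exact hle (Ideal.subset_span (by simpa using ⟨x, hx, rfl⟩))
      have h6 := hm.trans ((Ideal.radical_mono h5).trans (Ideal.IsPrime.radical inferInstance).le)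
      intro y hy
      obtain ⟨x, rfl⟩ := Ideal.Quotient.mk_surjective y
      exact h6 ((map_mem_nonunits_iff _ _).1 hy)
  have h2 := Ideal.height_le_card_of_mem_minimalPrimes_span_finset h1
  have h3 := IsLocalRing.maximalIdeal_height_eq_ringKrullDim (R := R ⧸ q.asIdeal)
  rw [h0] at h3
  have h4 : (maximalIdeal (R ⧸ q.asIdeal)).height = Order.coheight q := by exact_mod_cast h3
  rw [← h4]
  refine h2.trans ?_
  have := List.toFinset_card_le (l.map (Ideal.Quotient.mk q.asIdeal))
  simp only [List.length_map] at this
  exact_mod_cast this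

open IsLocalRing in
theorem regL_main [IsLocalRing R] [IsNoetherianRing R] (r : ℕ) : ∀ (I : Ideal R) (x f : List R),
    x.length = r → f.length = r → (∀ y ∈ x, y ∈ maximalIdeal R) →
    (∀ y ∈ f, y ∈ maximalIdeal R) → RegL I x →
    maximalIdeal R ≤ (I ⊔ ofList x).radical → maximalIdeal R ≤ (I ⊔ ofList f).radical →
    RegL I f := by
  induction r with
  | zero =>
    intro I x f _ hf _ _ _ _ _
    rw [List.length_eq_zero_iff.1 hf]; trivial
  | succ r ih =>
    intro I x f hx hf hxm hfm hreg h1 h2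
    obtain ⟨x1, xs, rfl⟩ := List.exists_cons_of_length_eq_add_one hx
    obtain ⟨f1, fs, rfl⟩ := List.exists_cons_of_length_eq_add_one hf
    simp only [List.length_cons, Nat.add_right_cancel_iff] at hx hf
    simp only [List.mem_cons, forall_eq_or_imp] at hxm hfm
    rw [ofList_cons, ← sup_assoc] at h1 h2
    obtain ⟨w, hw, hwm, hw1, hw2⟩ := exists_common r (I ⊔ span {x1}) (I ⊔ span {f1})
      (fun q hq => hx ▸ coheight_le_of_list xs _ hxm.2 h1 q hq)
      (fun q hq => hf ▸ coheight_le_of_list fs _ hfm.2 h2 q hq)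
    have r1 : RegL (I ⊔ span {x1}) w := ih _ xs w hx hw hxm.2 hwm hreg.2 h1 hw1
    have r2 : RegL I (w ++ [x1]) := regL_toEnd hxm.1 w ⟨hreg.1, r1⟩
    obtain ⟨k, hk⟩ := hw2 hxm.1
    have r3 : RegL I (f1 :: w) := regL_toFront w hwm (regL_exchange (k := k) w r2
      (by rwa [sup_assoc, sup_comm (ofList w), ← sup_assoc]))
    exact ⟨r3.1, ih _ w fs hw hf hwm hfm.2 r3.2 hw2 h2⟩
end


section
variable {R : Type*} [CommRing R]

lemma regL_last {a : R} (l : List R) : ∀ {I : Ideal R}, RegL I (l ++ [a]) →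
    ∀ z, a * z ∈ I ⊔ ofList l → z ∈ I ⊔ ofList l := by
  induction l with
  | nil => intro I h z hz; simpa using h.1 z (by simpa using hz)
  | cons b l ih =>
    intro I h z hz
    have := ih h.2 z (by simpa [ofList_cons, sup_assoc] using hz)
    simpa [ofList_cons, sup_assoc] using this

lemma regL_localization (M : Submonoid R) (S : Type*) [CommRing S] [Algebra R S]
    [IsLocalization M S] (l : List R) : ∀ {I : Ideal R}, RegL I l →
    RegL (I.map (algebraMap R S)) (l.map (algebraMap R S)) := by
  induction l with
  | nil => intro I _; trivial
  | cons b l ih =>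
    intro I h
    refine ⟨?_, ?_⟩
    · intro z hz
      obtain ⟨⟨a, s⟩, has⟩ := IsLocalization.surj M z
      have has : z * algebraMap R S s = algebraMap R S a := has
      have h1 : algebraMap R S (b * a) ∈ I.map (algebraMap R S) := by
        have := Ideal.mul_mem_right (algebraMap R S s) _ hz
        rw [mul_assoc, has] at this
        simpa using this
      rw [IsLocalization.algebraMap_mem_map_algebraMap_iff M] at h1
      obtain ⟨m, hm, hmI⟩ := h1
      have h2 : m * a ∈ I := h.1 _ (by convert hmI using 1; ring)
      have h3 : algebraMap R S a ∈ I.map (algebraMap R S) :=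
        (IsLocalization.algebraMap_mem_map_algebraMap_iff M _ _ _).2 ⟨m, hm, h2⟩
      rw [← has] at h3
      exact (Ideal.mul_unit_mem_iff_mem _ (IsLocalization.map_units S s)).1 h3
    · have := ih h.2
      rwa [Ideal.map_sup, Ideal.map_span, Set.image_singleton] at this
end

section
open MvPolynomial
variable {K : Type*} [Field K] {σ : Type*}

lemma regL_X (l : List σ) : ∀ (s : Set σ), (∀ i ∈ l, i ∉ s) → l.Nodup →
    RegL (Ideal.span (X '' s : Set (MvPolynomial σ K))) (l.map X) := by
  classical
  induction l with
  | nil => intro _ _ _; trivial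
  | cons b l ih =>
    intro s hs hl
    rw [List.nodup_cons] at hl
    refine ⟨?_, ?_⟩
    · intro z hz
      rw [mem_ideal_span_X_image] at hz ⊢
      intro m hm
      have : Finsupp.single b 1 + m ∈ (X b * z).support := by
        rw [mem_support_iff, coeff_X_mul]; exact mem_support_iff.1 hm
      obtain ⟨i, hi, hne⟩ := hz _ this
      refine ⟨i, hi, ?_⟩
      have hib : b ≠ i := by rintro rfl; exact hs b (by simp) hi
      simpa [Finsupp.single_apply, hib] using hne
    · have := ih (insert b s) (by
        intro i hi
        simp only [Set.mem_insert_iff, not_or]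
        refine ⟨?_, hs i (by simp [hi])⟩
        rintro rfl; exact hl.1 hi) hl.2
      rwa [Set.image_insert_eq, Ideal.span_insert, sup_comm] at this

lemma constantCoeff_eq_eval0 (f : MvPolynomial σ K) : constantCoeff f = eval (0 : σ → K) f := by
  have : (constantCoeff : MvPolynomial σ K →+* K) = eval (0 : σ → K) := by
    ext <;> simp
  rw [this]

lemma ker_eval_zero_eq [Finite σ] : RingHom.ker (eval (0 : σ → K)) = idealOfVars σ K := by
  rw [← pow_one (idealOfVars σ K)]
  ext f
  rw [mem_pow_idealOfVars_iff', RingHom.mem_ker, show eval (0 : σ → K) f = constantCoeff f by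
    rw [constantCoeff_eq_eval0]]
  constructor
  · intro h x hx
    have : x = 0 := (Finsupp.degree_eq_zero_iff x).1 (by omega)
    rw [this]; exact h
  · intro h; exact h 0 (by simp)

lemma syzygy_local [Fintype σ] (h c : σ → MvPolynomial σ K) (U : MvPolynomial σ K)
    (hU : eval 0 U ≠ 0) (h0 : ∀ i, eval 0 (h i) = 0)
    (hpow : ∀ i, ∃ k : ℕ, (U * X i) ^ k ∈ Ideal.span (Set.range h))
    (hc : ∑ i, h i * c i = 0) :
    ∃ v : MvPolynomial σ K, eval 0 v ≠ 0 ∧ ∀ i, v * c i ∈ Ideal.span (Set.range h) := by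
  classical
  let m : Ideal (MvPolynomial σ K) := RingHom.ker (eval (0 : σ → K))
  have : m.IsPrime := RingHom.ker_isPrime _
  let L := Localization.AtPrime m
  let φ : MvPolynomial σ K →+* L := algebraMap _ _
  have hmax : IsLocalRing.maximalIdeal L = m.map φ :=
    (Localization.AtPrime.map_eq_maximalIdeal (I := m)).symm
  have hLN : IsNoetherianRing L := IsLocalization.isNoetherianRing m.primeCompl _ inferInstance
  have hmX : ∀ A : Ideal L, (∀ i, φ (X i) ∈ A) → IsLocalRing.maximalIdeal L ≤ A := by
    intro A hA
    have hm : m = idealOfVars σ K := ker_eval_zero_eq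
    rw [hmax, Ideal.map_le_iff_le_comap]
    refine hm.le.trans ?_
    rw [idealOfVars, Ideal.span_le]
    rintro _ ⟨i, rfl⟩
    exact hA i
  have hmemL : ∀ f, eval (0 : σ → K) f = 0 → φ f ∈ IsLocalRing.maximalIdeal L := by
    intro f hf; rw [hmax]; exact Ideal.mem_map_of_mem _ hf
  have hUu : IsUnit (φ U) := IsLocalization.map_units L (⟨U, hU⟩ : m.primeCompl)
  have key : ∀ i, ∃ v : MvPolynomial σ K, eval 0 v ≠ 0 ∧ v * c i ∈ Ideal.span (Set.range h) := by
    intro i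
    let l := (Finset.univ.erase i).toList
    let l' := l ++ [i]
    have hl' : ∀ k, k ∈ l' := by
      intro k; simp only [l', l, List.mem_append, Finset.mem_toList, List.mem_singleton]
      by_cases hk : k = i <;> simp [hk]
    have hnd : l'.Nodup := by
      simp only [l', l]
      rw [List.nodup_append]
      refine ⟨Finset.nodup_toList _, by simp, ?_⟩
      intro a ha b hb
      simp at ha hb
      rw [hb]; exact ha
    have hx : RegL (⊥ : Ideal L) (l'.map (fun k => φ (X k))) := by
      have := regL_localization m.primeCompl L _ (regL_X (K := K) l' ∅ (by simp) hnd)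
      simpa [Function.comp_def] using this
    have hreg : RegL (⊥ : Ideal L) (l'.map (fun k => φ (h k))) := by
      refine regL_main l'.length ⊥ _ _ (by simp) (by simp) ?_ ?_ hx ?_ ?_
      · intro y hy
        obtain ⟨k, -, rfl⟩ := List.mem_map.1 hy
        exact hmemL _ (by simp)
      · intro y hy
        obtain ⟨k, -, rfl⟩ := List.mem_map.1 hy
        exact hmemL _ (h0 k)
      · apply hmX
        intro k
        apply Ideal.le_radical
        rw [bot_sup_eq]
        exact Ideal.subset_span (List.mem_map.2 ⟨k, hl' k, rfl⟩)
      · apply hmX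
        intro k
        obtain ⟨N, hN⟩ := hpow k
        refine ⟨N, ?_⟩
        have hle : (Ideal.span (Set.range h)).map φ ≤ ofList (l'.map (fun k => φ (h k))) := by
          rw [Ideal.map_span, Ideal.span_le]
          rintro _ ⟨_, ⟨j, rfl⟩, rfl⟩
          exact Ideal.subset_span (List.mem_map.2 ⟨j, hl' j, rfl⟩)
        rw [bot_sup_eq]
        apply hle
        have := Ideal.mem_map_of_mem φ hN
        rw [map_pow, map_mul, mul_pow] at this
        exact (Ideal.unit_mul_mem_iff_mem _ (hUu.pow N)).1 this
    have hle : (⊥ : Ideal L) ⊔ ofList (l.map (fun k => φ (h k))) ≤ (Ideal.span (Set.range h)).map φ := by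
      rw [bot_sup_eq]
      refine Ideal.span_le.2 ?_
      intro y hy
      obtain ⟨k, -, rfl⟩ := List.mem_map.1 hy
      exact Ideal.mem_map_of_mem _ (Ideal.subset_span ⟨k, rfl⟩)
    have h5 := hle (regL_last (a := φ (h i)) (l.map (fun k => φ (h k)))
      (by simpa [l'] using hreg) (φ (c i)) (by
        rw [← Finset.add_sum_erase _ _ (Finset.mem_univ i)] at hc
        have hc' := congrArg φ (eq_neg_of_add_eq_zero_left hc)
        rw [map_mul, map_neg, map_sum] at hc'
        rw [hc', bot_sup_eq]
        refine neg_mem (sum_mem fun k hk => ?_)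
        rw [map_mul]
        refine Ideal.mul_mem_right _ _ (Ideal.subset_span (List.mem_map.2 ⟨k, ?_, rfl⟩))
        simpa [l] using hk))
    rw [IsLocalization.algebraMap_mem_map_algebraMap_iff m.primeCompl] at h5
    obtain ⟨v, hv, hvI⟩ := h5
    exact ⟨v, hv, hvI⟩
  choose v hv hvI using key
  refine ⟨∏ i, v i, ?_, ?_⟩
  · rw [map_prod]; exact Finset.prod_ne_zero_iff.2 fun i _ => hv i
  · intro i
    rw [← Finset.prod_erase_mul _ _ (Finset.mem_univ i), mul_assoc]
    exact Ideal.mul_mem_left _ _ (hvI i)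
end

end


section
variable {K : Type*} [Field K] {σ : Type*}

/-- ideal generated by the variables -/
noncomputable def psm (K : Type*) [Field K] (σ : Type*) : Ideal (MvPowerSeries σ K) :=
  Ideal.span (Set.range (MvPowerSeries.X : σ → MvPowerSeries σ K))

lemma psm_coeff_zero (N : ℕ) : ∀ f ∈ psm K σ ^ N, ∀ x : σ →₀ ℕ, x.degree < N →
    MvPowerSeries.coeff x f = 0 := by
  classical
  induction N with
  | zero => intro f _ x hx; omega
  | succ N ih =>
    intro f hf
    rw [pow_succ'] at hf
    refine Submodule.mul_induction_on hf ?_ ?_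
    · intro a ha b hb
      induction ha using Submodule.span_induction with
      | mem a ha =>
        obtain ⟨i, rfl⟩ := ha
        intro x hx
        rw [MvPowerSeries.X, MvPowerSeries.coeff_monomial_mul]
        split_ifs with hle
        · rw [ih b hb, mul_zero]
          obtain ⟨y, rfl⟩ := exists_add_of_le hle
          simp only [add_tsub_cancel_left]
          simp [map_add] at hx
          omega
        · rfl
      | zero => intro x _; simp
      | add u v _ _ hu hv => intro x hx; rw [add_mul, map_add, hu x hx, hv x hx, add_zero]
      | smul r u _ hu =>
        intro x hx
        rw [smul_eq_mul, mul_assoc, MvPowerSeries.coeff_mul]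
        refine Finset.sum_eq_zero fun p hp => ?_
        rw [hu, mul_zero]
        rw [Finset.HasAntidiagonal.mem_antidiagonal] at hp
        rw [← hp, map_add] at hx
        omega
    · intro a b ha hb x hx
      rw [map_add, ha x hx, hb x hx, add_zero]

lemma psm_of_coeff_zero [Fintype σ] (N : ℕ) : ∀ f : MvPowerSeries σ K,
    (∀ x : σ →₀ ℕ, x.degree < N → MvPowerSeries.coeff x f = 0) → f ∈ psm K σ ^ N := by
  classical
  induction N with
  | zero => intro f _; simp
  | succ N ih =>
    intro f hf
    have hex : ∀ x : σ →₀ ℕ, ∃ i : Option σ, ∀ (_ : x ≠ 0), ∃ j, i = some j ∧ x j ≠ 0 := by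
      intro x
      by_cases hx : x = 0
      · exact ⟨none, fun h => absurd hx h⟩
      · obtain ⟨j, hj⟩ := Finsupp.ne_iff.1 hx
        exact ⟨some j, fun _ => ⟨j, rfl, hj⟩⟩
    choose c hc using hex
    let F : σ → MvPowerSeries σ K := fun i y =>
      if c (y + Finsupp.single i 1) = some i then MvPowerSeries.coeff (y + Finsupp.single i 1) f else 0
    have hF : ∀ i y, MvPowerSeries.coeff y (F i) = if c (y + Finsupp.single i 1) = some i
        then MvPowerSeries.coeff (y + Finsupp.single i 1) f else 0 := fun i y => rfl
    have hsum : f = ∑ i, MvPowerSeries.X i * F i := by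
      ext x
      rw [map_sum]
      by_cases hx : x = 0
      · subst hx
        rw [hf 0 (by simp)]
        symm
        refine Finset.sum_eq_zero fun i _ => ?_
        simp
      · obtain ⟨j, hj, hxj⟩ := hc x hx
        rw [Finset.sum_eq_single j]
        · rw [MvPowerSeries.X, MvPowerSeries.coeff_monomial_mul, if_pos, one_mul, hF,
            tsub_add_cancel_of_le, if_pos hj]
          · simpa [Nat.one_le_iff_ne_zero] using hxj
          · simpa [Nat.one_le_iff_ne_zero] using hxj
        · intro i _ hij
          rw [MvPowerSeries.X, MvPowerSeries.coeff_monomial_mul]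
          split_ifs with hle
          · rw [one_mul, hF, tsub_add_cancel_of_le hle, hj, if_neg]
            simpa using hij.symm
          · rfl
        · simp
    rw [hsum, pow_succ']
    refine sum_mem fun i _ => Ideal.mul_mem_mul (Ideal.subset_span ⟨i, rfl⟩) (ih _ ?_)
    intro y hy
    rw [hF]
    split_ifs
    · apply hf; simp [map_add]; omega
    · rfl

lemma mem_psm_pow_iff [Fintype σ] {N : ℕ} {f : MvPowerSeries σ K} : f ∈ psm K σ ^ N ↔
    ∀ x : σ →₀ ℕ, x.degree < N → MvPowerSeries.coeff x f = 0 :=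
  ⟨fun h => psm_coeff_zero N f h, psm_of_coeff_zero N f⟩

lemma mem_psm_iff [Fintype σ] {f : MvPowerSeries σ K} :
    f ∈ psm K σ ↔ MvPowerSeries.constantCoeff f = 0 := by
  rw [← pow_one (psm K σ), mem_psm_pow_iff]
  constructor
  · intro h; exact h 0 (by simp)
  · intro h x hx
    have : x = 0 := (Finsupp.degree_eq_zero_iff x).1 (by omega)
    rw [this]; exact h

lemma coe_mem_psm_pow_iff [Fintype σ] {N : ℕ} {f : MvPolynomial σ K} :
    (f : MvPowerSeries σ K) ∈ psm K σ ^ N ↔ f ∈ MvPolynomial.idealOfVars σ K ^ N := by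
  rw [mem_psm_pow_iff, MvPolynomial.mem_pow_idealOfVars_iff']
  simp

lemma truncTotal_sub_mem [Fintype σ] (N : ℕ) (f : MvPowerSeries σ K) :
    f - (MvPowerSeries.truncTotal N f : MvPolynomial σ K) ∈ psm K σ ^ N := by
  rw [mem_psm_pow_iff]
  intro x hx
  rw [map_sub, MvPolynomial.coeff_coe, MvPowerSeries.coeff_truncTotal _ hx, sub_self]

lemma aeval_mem_psm_pow [Fintype σ] {N : ℕ} {f : MvPolynomial σ K} (φ : σ → MvPowerSeries σ K)
    (hφ : ∀ i, φ i ∈ psm K σ) (hf : f ∈ MvPolynomial.idealOfVars σ K ^ N) :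
    MvPolynomial.aeval φ f ∈ psm K σ ^ N := by
  have h1 : (MvPolynomial.idealOfVars σ K).map (MvPolynomial.aeval φ).toRingHom ≤ psm K σ := by
    rw [Ideal.map_le_iff_le_comap, MvPolynomial.idealOfVars, Ideal.span_le]
    rintro _ ⟨i, rfl⟩
    simpa using hφ i
  have h2 := Ideal.mem_map_of_mem (MvPolynomial.aeval φ).toRingHom hf
  rw [Ideal.map_pow] at h2
  exact Ideal.pow_right_mono h1 N h2

lemma aeval_sub_mem {A : Type*} [CommRing A] [Algebra K A] (Q : Ideal A) (a b : σ → A)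
    (h : ∀ i, a i - b i ∈ Q) (f : MvPolynomial σ K) :
    MvPolynomial.aeval a f - MvPolynomial.aeval b f ∈ Q := by
  have h1 : (Ideal.Quotient.mkₐ K Q).comp (MvPolynomial.aeval a) =
      (Ideal.Quotient.mkₐ K Q).comp (MvPolynomial.aeval b) := by
    ext i
    simpa [Ideal.Quotient.eq] using h i
  rw [← Ideal.Quotient.eq]
  exact DFunLike.congr_fun h1 f

lemma aeval_X_ps (f : MvPolynomial σ K) :
    MvPolynomial.aeval (MvPowerSeries.X : σ → MvPowerSeries σ K) f = f := by
  have : (MvPolynomial.aeval (MvPowerSeries.X : σ → MvPowerSeries σ K)) =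
      MvPolynomial.coeToMvPowerSeries.algHom (σ := σ) (R := K) K := by
    ext i; simp [MvPolynomial.coeToMvPowerSeries.algHom_apply]
  rw [this, MvPolynomial.coeToMvPowerSeries.algHom_apply]
  simp

lemma aeval_taylor [Fintype σ] (ε : MvPowerSeries σ K) (b : σ → MvPowerSeries σ K)
    (hb : ∀ i, b i ∈ psm K σ) (hbX : ∀ i, b i - MvPowerSeries.X i ∈ Ideal.span {ε})
    (q : MvPolynomial σ K) (hq : q ∈ MvPolynomial.idealOfVars σ K ^ 2) :
    MvPolynomial.aeval b q - q ∈ psm K σ * Ideal.span {ε} := by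
  have hgen : ∀ r : MvPolynomial σ K, MvPolynomial.aeval b r - r ∈ Ideal.span {ε} := by
    intro r
    have := aeval_sub_mem (K := K) (Ideal.span {ε}) b MvPowerSeries.X hbX r
    rwa [aeval_X_ps] at this
  rw [pow_two] at hq
  refine Submodule.mul_induction_on hq ?_ ?_
  · intro u hu v hv
    rw [← pow_one (MvPolynomial.idealOfVars σ K)] at hu hv
    have hv' := aeval_mem_psm_pow b hb hv
    have hu' := coe_mem_psm_pow_iff.2 hu
    rw [pow_one] at hu' hv'
    have e : MvPolynomial.aeval b (u * v) - ((u * v : MvPolynomial σ K) : MvPowerSeries σ K) =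
        MvPolynomial.aeval b v * (MvPolynomial.aeval b u - u) +
        u * (MvPolynomial.aeval b v - v) := by
      rw [map_mul, MvPolynomial.coe_mul]; ring
    rw [e]
    exact add_mem (Ideal.mul_mem_mul hv' (hgen u)) (Ideal.mul_mem_mul hu' (hgen v))
  · intro u v hu hv
    have := add_mem hu hv
    rw [map_add, MvPolynomial.coe_add]
    convert this using 1; ring

lemma isUnit_of_not_mem_psm [Fintype σ] {f : MvPowerSeries σ K} (hf : f ∉ psm K σ) : IsUnit f := by
  rw [mem_psm_iff] at hf
  rw [MvPowerSeries.isUnit_iff_constantCoeff]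
  exact isUnit_iff_ne_zero.2 hf

/-- local algebra homs between quotients -/
lemma quot_lift_mem [Fintype σ] {g h : MvPowerSeries σ K}
    (T : (MvPowerSeries σ K ⧸ Ideal.span {g}) →ₐ[K] (MvPowerSeries σ K ⧸ Ideal.span {h}))
    (φ : σ → MvPowerSeries σ K) (hφ : ∀ i, φ i ∈ psm K σ)
    (hT : ∀ i, T (Ideal.Quotient.mk _ (MvPowerSeries.X i)) = Ideal.Quotient.mk _ (φ i))
    (N : ℕ) (f : MvPowerSeries σ K) (hf : f ∈ psm K σ ^ N) :
    ∃ f' ∈ psm K σ ^ N, T (Ideal.Quotient.mk _ f) = Ideal.Quotient.mk _ f' := by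
  let Φ : MvPowerSeries σ K →+* (MvPowerSeries σ K ⧸ Ideal.span {h}) :=
    T.toRingHom.comp (Ideal.Quotient.mk (Ideal.span {g}))
  have h1 : (psm K σ).map Φ ≤ (psm K σ).map (Ideal.Quotient.mk (Ideal.span {h})) := by
    rw [Ideal.map_le_iff_le_comap, psm, Ideal.span_le]
    rintro _ ⟨i, rfl⟩
    change T (Ideal.Quotient.mk _ (MvPowerSeries.X i)) ∈ (psm K σ).map (Ideal.Quotient.mk (Ideal.span {h}))
    rw [hT]
    exact Ideal.mem_map_of_mem _ (hφ i)
  have h2 := Ideal.mem_map_of_mem Φ hf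
  rw [Ideal.map_pow] at h2
  have h3 := Ideal.pow_right_mono h1 N h2
  rw [← Ideal.map_pow, Ideal.mem_map_iff_of_surjective _ Ideal.Quotient.mk_surjective] at h3
  obtain ⟨f', hf', he⟩ := h3
  exact ⟨f', hf', he.symm⟩

lemma quot_aeval {g h : MvPowerSeries σ K}
    (T : (MvPowerSeries σ K ⧸ Ideal.span {g}) →ₐ[K] (MvPowerSeries σ K ⧸ Ideal.span {h}))
    (φ : σ → MvPowerSeries σ K)
    (hT : ∀ i, T (Ideal.Quotient.mk _ (MvPowerSeries.X i)) = Ideal.Quotient.mk _ (φ i))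
    (q : MvPolynomial σ K) :
    T (Ideal.Quotient.mk _ (q : MvPowerSeries σ K)) = Ideal.Quotient.mk _ (MvPolynomial.aeval φ q) := by
  have : (T.comp (Ideal.Quotient.mkₐ K (Ideal.span {g}))).comp (MvPolynomial.aeval MvPowerSeries.X) =
      (Ideal.Quotient.mkₐ K (Ideal.span {h})).comp (MvPolynomial.aeval φ) := by
    ext i
    simpa using hT i
  have := DFunLike.congr_fun this q
  simpa [aeval_X_ps] using this

lemma quot_lift_var_mem [Fintype σ] {g h : MvPowerSeries σ K} (hg : g ∈ psm K σ)
    (T : (MvPowerSeries σ K ⧸ Ideal.span {g}) ≃ₐ[K] (MvPowerSeries σ K ⧸ Ideal.span {h}))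
    (i : σ) (φ : MvPowerSeries σ K)
    (hT : T (Ideal.Quotient.mk _ (MvPowerSeries.X i)) = Ideal.Quotient.mk _ φ) : φ ∈ psm K σ := by
  by_contra hn
  have h1 := (isUnit_of_not_mem_psm hn).map (Ideal.Quotient.mk (Ideal.span {h}))
  rw [← hT] at h1
  have h2 := h1.map T.symm
  rw [AlgEquiv.symm_apply_apply] at h2
  obtain ⟨c, hc⟩ := h2.exists_right_inv
  obtain ⟨c, rfl⟩ := Ideal.Quotient.mk_surjective c
  rw [← map_mul, ← map_one (Ideal.Quotient.mk _), Ideal.Quotient.eq] at hc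
  have h3 : Ideal.span {g} ≤ psm K σ := by
    rw [Ideal.span_le]; simpa using hg
  have h4 := mem_psm_iff.1 (h3 hc)
  simp at h4
end


section
variable {K : Type*} [Field K] {σ : Type*} [Fintype σ]

lemma aeval_chain {A : Type*} [CommRing A] [Algebra K A] (D : Derivation K A A) (φ : σ → A)
    (q : MvPolynomial σ K) :
    D (MvPolynomial.aeval φ q) = ∑ j, MvPolynomial.aeval φ (MvPolynomial.pderiv j q) * D (φ j) := by
  classical
  induction q using MvPolynomial.induction_on with
  | C a => simp
  | add u v hu hv => simp only [map_add, hu, hv, add_mul, Finset.sum_add_distrib]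
  | mul_X u i hu =>
    simp only [map_mul, Derivation.leibniz, hu, MvPolynomial.aeval_X, smul_eq_mul,
      MvPolynomial.pderiv_X, map_add, add_mul, Finset.sum_add_distrib, Finset.mul_sum]
    congr 1
    · rw [Finset.sum_eq_single i]
      · simp
      · intro b _ hb; simp [Pi.single_apply, hb.symm]
      · simp
    · refine Finset.sum_congr rfl fun j _ => by ring

lemma degree_lt_two {x : σ →₀ ℕ} (hx : x.degree < 2) : x = 0 ∨ ∃ k, x = Finsupp.single k 1 := by
  classical
  by_cases h : x = 0
  · exact Or.inl h
  right
  obtain ⟨k, hk⟩ := Finsupp.ne_iff.1 h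
  refine ⟨k, ?_⟩
  have hle : Finsupp.single k 1 ≤ x := by simpa [Nat.one_le_iff_ne_zero] using hk
  obtain ⟨y, rfl⟩ := exists_add_of_le hle
  have : y.degree = 0 := by
    rw [map_add, Finsupp.degree_single] at hx; omega
  rw [(Finsupp.degree_eq_zero_iff y).1 this, add_zero]

lemma linear_part [DecidableEq σ] (ψ : MvPowerSeries σ K) (h : ψ ∈ psm K σ) :
    ψ - ∑ j, MvPowerSeries.coeff (Finsupp.single j 1) ψ • (MvPowerSeries.X j : MvPowerSeries σ K)
      ∈ psm K σ ^ 2 := by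
  rw [mem_psm_pow_iff]
  intro x hx
  rcases degree_lt_two hx with rfl | ⟨k, rfl⟩
  · have := mem_psm_iff.1 h
    simp only [map_sub, map_sum, MvPowerSeries.coeff_smul, MvPowerSeries.coeff_zero_X, mul_zero,
      Finset.sum_const_zero, sub_zero]
    exact this
  · simp only [map_sub, map_sum, MvPowerSeries.coeff_smul, MvPowerSeries.coeff_X]
    rw [Finset.sum_eq_single k]
    · simp
    · intro b _ hb
      rw [if_neg, mul_zero]
      intro h
      exact hb ((Finsupp.single_left_inj one_ne_zero).1 h).symm
    · simp

lemma jac_unit [DecidableEq σ] {g h : MvPowerSeries σ K} (hh : h ∈ psm K σ ^ 2)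
    (T : (MvPowerSeries σ K ⧸ Ideal.span {g}) →ₐ[K] (MvPowerSeries σ K ⧸ Ideal.span {h}))
    (φ ψ : σ → MvPowerSeries σ K) (hφ : ∀ i, φ i ∈ psm K σ) (hψ : ∀ i, ψ i ∈ psm K σ)
    (hT : ∀ i, T (Ideal.Quotient.mk _ (MvPowerSeries.X i)) = Ideal.Quotient.mk _ (φ i))
    (hT' : ∀ i, T (Ideal.Quotient.mk _ (ψ i)) = Ideal.Quotient.mk _ (MvPowerSeries.X i)) :
    IsUnit (Matrix.of fun k j => MvPowerSeries.pderiv K k (φ j)).det := by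
  let Cm : Matrix σ σ K := Matrix.of fun i j => MvPowerSeries.coeff (Finsupp.single j 1) (ψ i)
  let L : Matrix σ σ K := Matrix.of fun j k => MvPowerSeries.coeff (Finsupp.single k 1) (φ j)
  have hCL : Cm * L = 1 := by
    ext i k
    obtain ⟨t, ht, hTt⟩ := quot_lift_mem T φ hφ hT 2 _ (linear_part (ψ i) (hψ i))
    have key : (MvPowerSeries.X i : MvPowerSeries σ K) -
        ∑ j, MvPowerSeries.coeff (Finsupp.single j 1) (ψ i) • φ j - t ∈ Ideal.span {h} := by
      rw [← Ideal.Quotient.eq_zero_iff_mem]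
      have e : T (Ideal.Quotient.mk _ (ψ i - ∑ j, MvPowerSeries.coeff (Finsupp.single j 1) (ψ i) •
          (MvPowerSeries.X j : MvPowerSeries σ K))) =
          Ideal.Quotient.mk _ ((MvPowerSeries.X i : MvPowerSeries σ K) -
        ∑ j, MvPowerSeries.coeff (Finsupp.single j 1) (ψ i) • φ j) := by
        have hs : ∀ (I : Ideal (MvPowerSeries σ K)) (c : K) (f : MvPowerSeries σ K),
          Ideal.Quotient.mk I (c • f) = c • Ideal.Quotient.mk I f := fun I c f => rfl
        simp only [map_sub, map_sum, hs, map_smul, hT, hT']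
      rw [map_sub, ← e, hTt, sub_self]
    have key2 : (MvPowerSeries.X i : MvPowerSeries σ K) -
        ∑ j, MvPowerSeries.coeff (Finsupp.single j 1) (ψ i) • φ j ∈ psm K σ ^ 2 := by
      have h3 : Ideal.span {h} ≤ psm K σ ^ 2 := by rw [Ideal.span_le]; simpa using hh
      have := add_mem (h3 key) ht
      simpa using this
    have key3 := mem_psm_pow_iff.1 key2 (Finsupp.single k 1) (by simp)
    simp only [map_sub, map_sum, MvPowerSeries.coeff_smul, MvPowerSeries.coeff_X] at key3
    rw [Matrix.mul_apply, Matrix.one_apply]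
    rw [sub_eq_zero] at key3
    simp only [Cm, L, Matrix.of_apply]
    rw [← key3]
    by_cases hik : i = k
    · subst hik; simp
    · rw [if_neg, if_neg hik]
      intro h
      exact hik ((Finsupp.single_left_inj one_ne_zero).1 h).symm
  have hL : L.det ≠ 0 := by
    intro h0
    have := congrArg Matrix.det hCL
    rw [Matrix.det_mul, h0, mul_zero, Matrix.det_one] at this
    exact zero_ne_one this
  rw [MvPowerSeries.isUnit_iff_constantCoeff, RingHom.map_det, isUnit_iff_ne_zero]
  convert hL using 1
  rw [← Matrix.det_transpose]
  congr 1
  ext j k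
  simp only [RingHom.mapMatrix_apply, Matrix.transpose_apply, Matrix.map_apply, Matrix.of_apply, L]
  rw [← MvPowerSeries.coeff_zero_eq_constantCoeff_apply, MvPowerSeries.coeff_pderiv]
  simp

lemma eq_zero_of_forall_mem {f : MvPowerSeries σ K} (hf : ∀ N, f ∈ psm K σ ^ N) : f = 0 := by
  ext x
  exact psm_coeff_zero (x.degree + 1) f (hf _) x (by omega)

lemma e_unit (h g : MvPolynomial σ K) (hh : h ∈ MvPolynomial.idealOfVars σ K ^ 2)
    (T : (MvPowerSeries σ K ⧸ Ideal.span {(g : MvPowerSeries σ K)}) →ₐ[K]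
      (MvPowerSeries σ K ⧸ Ideal.span {(h : MvPowerSeries σ K)}))
    (φ ψ : σ → MvPowerSeries σ K) (hφ : ∀ i, φ i ∈ psm K σ) (hψ : ∀ i, ψ i ∈ psm K σ)
    (hT : ∀ i, T (Ideal.Quotient.mk _ (MvPowerSeries.X i)) = Ideal.Quotient.mk _ (φ i))
    (hT' : ∀ i, T (Ideal.Quotient.mk _ (ψ i)) = Ideal.Quotient.mk _ (MvPowerSeries.X i))
    (e e' : MvPowerSeries σ K) (he : MvPolynomial.aeval φ g = e * h)
    (he' : MvPolynomial.aeval ψ h = e' * g) (hz : (h : MvPowerSeries σ K) ≠ 0) : IsUnit e := by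
  by_contra hne
  have hem : e ∈ psm K σ := by
    by_contra h'; exact hne (isUnit_of_not_mem_psm h')
  refine hz (eq_zero_of_forall_mem fun N' => ?_)
  obtain ⟨N, hN, hN1⟩ : ∃ N, N' ≤ N ∧ 1 ≤ N := ⟨N' + 1, by omega, by omega⟩
  refine Ideal.pow_le_pow_right hN ?_
  let ψN : σ → MvPolynomial σ K := fun i => MvPowerSeries.truncTotal N (ψ i)
  let eN : MvPolynomial σ K := MvPowerSeries.truncTotal N e'
  have hψN : ∀ i, ψ i - (ψN i : MvPowerSeries σ K) ∈ psm K σ ^ N :=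
    fun i => truncTotal_sub_mem N (ψ i)
  have hq : MvPolynomial.aeval ψN h - eN * g ∈ MvPolynomial.idealOfVars σ K ^ N := by
    rw [← coe_mem_psm_pow_iff]
    have c1 : ((MvPolynomial.aeval ψN h : MvPolynomial σ K) : MvPowerSeries σ K) =
        MvPolynomial.aeval (fun i => (ψN i : MvPowerSeries σ K)) h := by
      rw [← aeval_X_ps, MvPolynomial.comp_aeval_apply]
      simp only [aeval_X_ps]
    have c2 := aeval_sub_mem (K := K) (psm K σ ^ N) _ _ hψN h
    have c3 : (e' - (eN : MvPowerSeries σ K)) * g ∈ psm K σ ^ N :=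
      Ideal.mul_mem_right _ _ (truncTotal_sub_mem N e')
    rw [← aeval_X_ps, map_sub, map_mul, aeval_X_ps, aeval_X_ps, aeval_X_ps, c1]
    have := sub_mem c3 c2
    convert this using 1
    rw [he']; ring
  have hq2 := aeval_mem_psm_pow φ hφ hq
  -- aeval φ (ψN i) = X i + h s_i + t_i
  have hb : ∀ i, ∃ b t : MvPowerSeries σ K, t ∈ psm K σ ^ N ∧
      b - MvPowerSeries.X i ∈ Ideal.span {(h : MvPowerSeries σ K)} ∧
      MvPolynomial.aeval φ (ψN i) - b ∈ psm K σ ^ N := by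
    intro i
    obtain ⟨t, ht, hTt⟩ := quot_lift_mem T φ hφ hT N _ (hψN i)
    rw [map_sub, map_sub, hT', quot_aeval T φ hT, ← map_sub, Ideal.Quotient.eq] at hTt
    refine ⟨MvPolynomial.aeval φ (ψN i) + t, t, ht, ?_, ?_⟩
    · have := neg_mem hTt
      convert this using 1; ring
    · simpa using ht
  choose b t ht hbX hbN using hb
  have hhps : (h : MvPowerSeries σ K) ∈ psm K σ := by
    have := coe_mem_psm_pow_iff.2 hh
    exact Ideal.pow_le_self two_ne_zero this
  have hbm : ∀ i, b i ∈ psm K σ := by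
    intro i
    have h3 : Ideal.span {(h : MvPowerSeries σ K)} ≤ psm K σ := by
      rw [Ideal.span_le]; simpa using hhps
    have := add_mem (h3 (hbX i)) (Ideal.subset_span ⟨i, rfl⟩ : MvPowerSeries.X i ∈ psm K σ)
    simpa using this
  have k1 := aeval_sub_mem (K := K) (psm K σ ^ N) _ _ hbN h
  have k2 := aeval_taylor (h : MvPowerSeries σ K) b hbm hbX h hh
  rw [Ideal.mem_mul_span_singleton] at k2
  obtain ⟨μ, hμ, hμe⟩ := k2
  have c4 : MvPolynomial.aeval φ (MvPolynomial.aeval ψN h) =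
      MvPolynomial.aeval (fun i => MvPolynomial.aeval φ (ψN i)) h := by
    rw [MvPolynomial.comp_aeval_apply]
  rw [map_sub, map_mul, he, c4] at hq2
  have k3 := sub_mem hq2 k1
  have k4 : (1 + μ - MvPolynomial.aeval φ eN * e) * h ∈ psm K σ ^ N := by
    convert k3 using 1
    linear_combination hμe
  have hu : IsUnit (1 + μ - MvPolynomial.aeval φ eN * e) := by
    apply isUnit_of_not_mem_psm
    rw [mem_psm_iff]
    simp [mem_psm_iff.1 hμ, mem_psm_iff.1 hem]
  obtain ⟨u, hu⟩ := hu
  rw [← hu] at k4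
  have := Ideal.mul_mem_left (psm K σ ^ N) (↑u⁻¹) k4
  rwa [Units.inv_mul_cancel_left] at this

lemma lemmaW (h g : MvPolynomial σ K) (hh : h ∈ MvPolynomial.idealOfVars σ K ^ 2)
    (α : σ → ℕ) (hα : ∀ i, 0 < α i) (d : ℕ) (hd : (d : K) ≠ 0)
    (hg : MvPolynomial.IsWeightedHomogeneous α g d)
    (E : (MvPowerSeries σ K ⧸ Ideal.span {(h : MvPowerSeries σ K)}) ≃ₐ[K]
      (MvPowerSeries σ K ⧸ Ideal.span {(g : MvPowerSeries σ K)})) :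
    ∃ a : σ → MvPowerSeries σ K, (∀ i, a i ∈ psm K σ) ∧
      (h : MvPowerSeries σ K) = ∑ i, a i * (MvPolynomial.pderiv i h : MvPolynomial σ K) := by
  classical
  by_cases hz : (h : MvPowerSeries σ K) = 0
  · exact ⟨0, fun i => zero_mem _, by
      rw [hz]; simp⟩
  have hhps : (h : MvPowerSeries σ K) ∈ psm K σ ^ 2 := coe_mem_psm_pow_iff.2 hh
  have hhps1 : (h : MvPowerSeries σ K) ∈ psm K σ := Ideal.pow_le_self two_ne_zero hhps
  have hgps : (g : MvPowerSeries σ K) ∈ psm K σ := by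
    rw [mem_psm_iff, ← MvPowerSeries.coeff_zero_eq_constantCoeff_apply, MvPolynomial.coeff_coe]
    by_contra h0
    have := hg h0
    simp at this
    apply hd; rw [← this]; simp
  have hφ0 : ∀ j, ∃ φ, E.symm (Ideal.Quotient.mk _ (MvPowerSeries.X j)) = Ideal.Quotient.mk _ φ :=
    fun j => ⟨_, (Ideal.Quotient.mk_surjective (E.symm (Ideal.Quotient.mk _ (MvPowerSeries.X j)))).choose_spec.symm⟩
  have hψ0 : ∀ j, ∃ ψ, E (Ideal.Quotient.mk _ (MvPowerSeries.X j)) = Ideal.Quotient.mk _ ψ :=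
    fun j => ⟨_, (Ideal.Quotient.mk_surjective (E (Ideal.Quotient.mk _ (MvPowerSeries.X j)))).choose_spec.symm⟩
  choose φ hφT using hφ0
  choose ψ hψT using hψ0
  have hφ : ∀ i, φ i ∈ psm K σ := fun i => quot_lift_var_mem hgps E.symm i _ (hφT i)
  have hψ : ∀ i, ψ i ∈ psm K σ := fun i => quot_lift_var_mem hhps1 E i _ (hψT i)
  have hT' : ∀ i, E.symm (Ideal.Quotient.mk _ (ψ i)) = Ideal.Quotient.mk _ (MvPowerSeries.X i) := by
    intro i; rw [← hψT, AlgEquiv.symm_apply_apply]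
  have he : ∃ e, MvPolynomial.aeval φ g = e * (h : MvPowerSeries σ K) := by
    have := quot_aeval E.symm.toAlgHom φ hφT g
    rw [Ideal.Quotient.eq_zero_iff_mem.2 (Ideal.mem_span_singleton_self _), map_zero] at this
    obtain ⟨e, he⟩ := Ideal.mem_span_singleton'.1 (Ideal.Quotient.eq_zero_iff_mem.1 this.symm)
    exact ⟨e, he.symm⟩
  have he' : ∃ e, MvPolynomial.aeval ψ h = e * (g : MvPowerSeries σ K) := by
    have := quot_aeval E.toAlgHom ψ hψT h
    rw [Ideal.Quotient.eq_zero_iff_mem.2 (Ideal.mem_span_singleton_self _), map_zero] at this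
    obtain ⟨e, he⟩ := Ideal.mem_span_singleton'.1 (Ideal.Quotient.eq_zero_iff_mem.1 this.symm)
    exact ⟨e, he.symm⟩
  obtain ⟨e, he⟩ := he
  obtain ⟨e', he'⟩ := he'
  have heu := e_unit h g hh E.symm.toAlgHom φ ψ hφ hψ hφT hT' e e' he he' hz
  have hJ := jac_unit hhps E.symm.toAlgHom φ ψ hφ hψ hφT hT'
  set D : Matrix σ σ (MvPowerSeries σ K) :=
    Matrix.of fun k j => MvPowerSeries.pderiv K k (φ j) with hD
  have hDM : D * D⁻¹ = 1 := Matrix.mul_nonsing_inv _ hJ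
  have hMD : D⁻¹ * D = 1 := Matrix.nonsing_inv_mul _ hJ
  let γ : σ → MvPowerSeries σ K := fun j => MvPolynomial.aeval φ (MvPolynomial.pderiv j g)
  have hchain : ∀ k, MvPowerSeries.pderiv K k (e * (h : MvPowerSeries σ K)) = D.mulVec γ k := by
    intro k
    rw [← he, aeval_chain]
    simp only [Matrix.mulVec, dotProduct, hD, Matrix.of_apply, γ]
    exact Finset.sum_congr rfl fun j _ => mul_comm _ _
  have hγ : ∀ j, γ j = ∑ k, D⁻¹ j k * MvPowerSeries.pderiv K k (e * (h : MvPowerSeries σ K)) := by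
    intro j
    have : γ = D⁻¹.mulVec (D.mulVec γ) := by
      rw [Matrix.mulVec_mulVec, hMD, Matrix.one_mulVec]
    conv_lhs => rw [this]
    simp only [hchain]
    rfl
  have hEuler : ∑ j, (α j : MvPowerSeries σ K) * φ j * γ j = (d : MvPowerSeries σ K) * (e * h) := by
    have := congrArg (MvPolynomial.aeval φ) (hg.sum_weight_X_mul_pderiv)
    simp only [map_sum, map_mul, map_nsmul, MvPolynomial.aeval_X, he, nsmul_eq_mul, map_natCast] at this
    rw [← this]
    exact Finset.sum_congr rfl fun j _ => by simp only [γ]; ring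
  let A : σ → MvPowerSeries σ K := fun k => ∑ j, (α j : MvPowerSeries σ K) * φ j * D⁻¹ j k
  have hA : ∀ k, A k ∈ psm K σ := fun k => sum_mem fun j _ =>
    Ideal.mul_mem_right _ _ (Ideal.mul_mem_left _ _ (hφ j))
  have hfin : ∑ k, A k * MvPowerSeries.pderiv K k (e * (h : MvPowerSeries σ K)) = (d : MvPowerSeries σ K) * (e * h) := by
    rw [← hEuler]
    simp only [A, hγ, Finset.sum_mul, Finset.mul_sum]
    rw [Finset.sum_comm]
    exact Finset.sum_congr rfl fun j _ => Finset.sum_congr rfl fun k _ => by ring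
  simp only [Derivation.leibniz, smul_eq_mul, MvPowerSeries.pderiv_coe] at hfin
  have hfac : ((d : MvPowerSeries σ K) * e - ∑ k, A k * MvPowerSeries.pderiv K k e) * h =
      ∑ k, A k * e * (MvPolynomial.pderiv k h : MvPolynomial σ K) := by
    rw [sub_mul, Finset.sum_mul, sub_eq_iff_eq_add, ← Finset.sum_add_distrib, mul_assoc, ← hfin]
    exact Finset.sum_congr rfl fun k _ => by ring
  have hu : IsUnit ((d : MvPowerSeries σ K) * e - ∑ k, A k * MvPowerSeries.pderiv K k e) := by
    rw [MvPowerSeries.isUnit_iff_constantCoeff] at heu ⊢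
    have : ∀ k, MvPowerSeries.constantCoeff (A k) = 0 := fun k => mem_psm_iff.1 (hA k)
    simp only [map_sub, map_mul, map_natCast, map_sum, this, zero_mul, Finset.sum_const_zero,
      sub_zero]
    exact (isUnit_iff_ne_zero.2 hd).mul heu
  obtain ⟨u, hu⟩ := hu
  refine ⟨fun k => ↑u⁻¹ * (A k * e), fun k => Ideal.mul_mem_left _ _
    (Ideal.mul_mem_right _ _ (hA k)), ?_⟩
  rw [← hu] at hfac
  have := congrArg (fun z => (↑u⁻¹ : MvPowerSeries σ K) * z) hfac
  simp only [Units.inv_mul_cancel_left] at this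
  rw [this, Finset.mul_sum]
  exact Finset.sum_congr rfl fun k _ => by ring
end

section
variable {K : Type*} [Field K] {σ : Type*} [Fintype σ]

lemma eval_zero_mem {f : MvPolynomial σ K} :
    f ∈ MvPolynomial.idealOfVars σ K ↔ MvPolynomial.eval 0 f = 0 := by
  rw [← ker_eval_zero_eq, RingHom.mem_ker]

lemma iso_pow [IsAlgClosed K] (h : MvPolynomial σ K) (hiso : IsIsolatedCriticalAtZero h) :
    ∃ U : MvPolynomial σ K, MvPolynomial.eval 0 U ≠ 0 ∧ ∀ i, ∃ k, (U * MvPolynomial.X i) ^ k ∈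
      Ideal.span (Set.range fun i => MvPolynomial.pderiv i h) := by
  obtain ⟨-, U, hU, hz⟩ := hiso
  refine ⟨U, hU, fun i => ?_⟩
  change U * MvPolynomial.X i ∈ Ideal.radical _
  rw [← MvPolynomial.vanishingIdeal_zeroLocus_eq_radical (K := K),
    MvPolynomial.mem_vanishingIdeal_iff]
  intro y hy
  rw [MvPolynomial.mem_zeroLocus_iff] at hy
  by_cases hu : MvPolynomial.eval y U = 0
  · rw [map_mul, MvPolynomial.aeval_eq_eval, hu, zero_mul]
  · have := hz y hu (fun i => by
      have := hy _ (Ideal.subset_span ⟨i, rfl⟩)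
      rwa [MvPolynomial.aeval_eq_eval] at this)
    simp [this]

lemma mem_vars_sq (h : MvPolynomial σ K) (h0 : MvPolynomial.eval 0 h = 0)
    (h1 : ∀ i, MvPolynomial.eval 0 (MvPolynomial.pderiv i h) = 0) :
    h ∈ MvPolynomial.idealOfVars σ K ^ 2 := by
  classical
  rw [MvPolynomial.mem_pow_idealOfVars_iff']
  intro x hx
  rcases degree_lt_two hx with rfl | ⟨k, rfl⟩
  · rw [← constantCoeff_eq_eval0] at h0
    exact h0
  · have := h1 k
    rw [← constantCoeff_eq_eval0, MvPolynomial.constantCoeff_eq, MvPolynomial.coeff_pderiv] at this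
    simpa using this

lemma poly_W (h U : MvPolynomial σ K) (hU : MvPolynomial.eval 0 U ≠ 0)
    (hpow : ∀ i, ∃ k, (U * MvPolynomial.X i) ^ k ∈
      Ideal.span (Set.range fun i => MvPolynomial.pderiv i h))
    (a : σ → MvPowerSeries σ K) (ha : ∀ i, a i ∈ psm K σ)
    (hs : (h : MvPowerSeries σ K) = ∑ i, a i * (MvPolynomial.pderiv i h : MvPolynomial σ K)) :
    ∃ (u : MvPolynomial σ K) (b : σ → MvPolynomial σ K), MvPolynomial.eval 0 u ≠ 0 ∧
      (∀ i, MvPolynomial.eval 0 (b i) = 0) ∧ u * h = ∑ i, b i * MvPolynomial.pderiv i h := by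
  set J := Ideal.span (Set.range fun i => MvPolynomial.pderiv i h) with hJ
  have hle : Ideal.span {U} * MvPolynomial.idealOfVars σ K ≤ J.radical := by
    rw [MvPolynomial.idealOfVars, Ideal.span_mul_span', Ideal.span_le]
    rintro _ ⟨_, rfl, _, ⟨i, rfl⟩, rfl⟩
    exact hpow i
  obtain ⟨N, hN⟩ := Ideal.exists_pow_le_of_le_radical_of_fg hle (IsNoetherian.noetherian _)
  let A : σ → MvPolynomial σ K := fun i => MvPowerSeries.truncTotal (N + 1) (a i)
  have hA : ∀ i, a i - (A i : MvPowerSeries σ K) ∈ psm K σ ^ (N + 1) :=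
    fun i => truncTotal_sub_mem (N + 1) (a i)
  have hA0 : ∀ i, MvPolynomial.eval 0 (A i) = 0 := by
    intro i
    rw [← eval_zero_mem, ← pow_one (MvPolynomial.idealOfVars σ K), ← coe_mem_psm_pow_iff, pow_one]
    have h1 := Ideal.pow_le_self (Nat.succ_ne_zero N) (hA i)
    have := sub_mem (ha i) h1
    simpa using this
  have ht : h - ∑ i, A i * MvPolynomial.pderiv i h ∈ MvPolynomial.idealOfVars σ K ^ (N + 1) := by
    rw [← coe_mem_psm_pow_iff, ← aeval_X_ps, map_sub, map_sum]
    simp only [map_mul, aeval_X_ps]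
    rw [hs, ← Finset.sum_sub_distrib]
    refine sum_mem fun i _ => ?_
    rw [← sub_mul]
    exact Ideal.mul_mem_right _ _ (hA i)
  have ht2 : U ^ N * (h - ∑ i, A i * MvPolynomial.pderiv i h) ∈
      MvPolynomial.idealOfVars σ K • Submodule.span (MvPolynomial σ K)
        (Set.range fun i => MvPolynomial.pderiv i h) := by
    change _ ∈ MvPolynomial.idealOfVars σ K * J
    refine Ideal.mul_mono_right hN ?_
    rw [mul_pow, mul_left_comm, ← pow_succ']
    exact Ideal.mul_mem_mul (Ideal.pow_mem_pow (Ideal.mem_span_singleton_self U) N) ht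
  rw [Submodule.mem_ideal_smul_span_iff_exists_sum] at ht2
  obtain ⟨b, hb, hbs⟩ := ht2
  rw [Finsupp.sum_fintype _ _ (by simp)] at hbs
  refine ⟨U ^ N, fun i => U ^ N * A i + b i, ?_, ?_, ?_⟩
  · rw [map_pow]; exact pow_ne_zero _ hU
  · intro i
    rw [map_add, map_mul, hA0, eval_zero_mem.1 (hb i)]; simp
  · simp only [smul_eq_mul] at hbs
    simp only [add_mul, Finset.sum_add_distrib, hbs, mul_sub, Finset.mul_sum, mul_assoc]
    ring

lemma local_core [IsAlgClosed K] (h g : MvPolynomial σ K) (δ δ' : ℕ) (hδ' : (δ' : K) ≠ 0)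
    (hiso : IsIsolatedCriticalAtZero h) (h0 : MvPolynomial.eval 0 h = 0)
    (d : ℕ) (hd : (d : K) ≠ 0) (hw : WeightedHomogSing h d)
    (hg : MvPolynomial.eval 0 g ≠ 0)
    (y w z : σ → MvPolynomial σ K) (W Z Fj Gj : MvPolynomial σ K)
    (hFj : ∑ i, y i * MvPolynomial.pderiv i h + Fj = (δ : MvPolynomial σ K) * h)
    (hGj : ∑ i, y i * MvPolynomial.pderiv i g + Gj = (δ' : MvPolynomial σ K) * g)
    (H1 : ∑ i, MvPolynomial.pderiv i h * w i + Fj * W = 0)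
    (H2 : ∑ i, MvPolynomial.pderiv i g * w i + Gj * W =
      ∑ i, MvPolynomial.pderiv i h * z i + Fj * Z) :
    ∃ q : MvPolynomial σ K, MvPolynomial.eval 0 q ≠ 0 ∧
      q * W ∈ Ideal.span (Set.range fun i => MvPolynomial.pderiv i h) := by
  obtain ⟨U, hU, hpow⟩ := iso_pow h hiso
  obtain ⟨g0, ⟨α, hα, -, hhom⟩, ⟨E⟩⟩ := hw
  obtain ⟨a, ha, hs⟩ := lemmaW h g0 (mem_vars_sq h h0 hiso.1) α hα d hd hhom E
  obtain ⟨u, b, hu, hb, hub⟩ := poly_W h U hU hpow a ha hs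
  set J := Ideal.span (Set.range fun i => MvPolynomial.pderiv i h) with hJ
  have hJi : ∀ i, MvPolynomial.pderiv i h ∈ J := fun i => Ideal.subset_span ⟨i, rfl⟩
  have H1' : ∑ i, MvPolynomial.pderiv i h * (w i - y i * W) + (δ : MvPolynomial σ K) * h * W = 0 := by
    rw [← hFj, ← H1]
    simp only [mul_sub, Finset.sum_sub_distrib, add_mul, Finset.sum_mul]
    have : ∀ i, MvPolynomial.pderiv i h * (y i * W) = y i * MvPolynomial.pderiv i h * W :=
      fun i => by ring
    simp only [this]; ring
  have H2' : ∑ i, MvPolynomial.pderiv i g * (w i - y i * W) + (δ' : MvPolynomial σ K) * g * W =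
      ∑ i, MvPolynomial.pderiv i h * z i + Fj * Z := by
    rw [← hGj, ← H2]
    simp only [mul_sub, Finset.sum_sub_distrib, add_mul, Finset.sum_mul]
    have : ∀ i, MvPolynomial.pderiv i g * (y i * W) = y i * MvPolynomial.pderiv i g * W :=
      fun i => by ring
    simp only [this]; ring
  have hsyz : ∑ i, MvPolynomial.pderiv i h *
      (u * (w i - y i * W) + (δ : MvPolynomial σ K) * b i * W) = 0 := by
    have e1 : ∀ i, MvPolynomial.pderiv i h *
      (u * (w i - y i * W) + (δ : MvPolynomial σ K) * b i * W) =
      u * (MvPolynomial.pderiv i h * (w i - y i * W)) +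
      ((δ : MvPolynomial σ K) * W) * (b i * MvPolynomial.pderiv i h) := fun i => by ring
    simp only [e1, Finset.sum_add_distrib, ← Finset.mul_sum, ← hub]
    linear_combination u * H1'
  obtain ⟨v, hv, hvJ⟩ := syzygy_local (fun i => MvPolynomial.pderiv i h) _ U hU hiso.1 hpow hsyz
  refine ⟨(δ' : MvPolynomial σ K) * g * u * v -
    (δ : MvPolynomial σ K) * v * ∑ i, MvPolynomial.pderiv i g * b i, ?_, ?_⟩
  · simp only [map_sub, map_mul, map_sum, hb, mul_zero, Finset.sum_const_zero, sub_zero,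
      map_natCast]
    exact mul_ne_zero (mul_ne_zero (mul_ne_zero hδ' hg) hu) hv
  · have huh : u * h ∈ J := by
      rw [hub]; exact sum_mem fun i _ => Ideal.mul_mem_left _ _ (hJi i)
    have huF : u * Fj ∈ J := by
      have : u * Fj = (δ : MvPolynomial σ K) * (u * h) -
          u * ∑ i, y i * MvPolynomial.pderiv i h := by
        linear_combination u * hFj
      rw [this]
      exact sub_mem (Ideal.mul_mem_left _ _ huh) (Ideal.mul_mem_left _ _
        (sum_mem fun i _ => Ideal.mul_mem_left _ _ (hJi i)))
    have m1 : u * v * (∑ i, MvPolynomial.pderiv i h * z i + Fj * Z) ∈ J := by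
      rw [mul_add]
      refine add_mem (Ideal.mul_mem_left _ _ (sum_mem fun i _ => Ideal.mul_mem_right _ _ (hJi i))) ?_
      have : u * v * (Fj * Z) = (v * Z) * (u * Fj) := by ring
      rw [this]; exact Ideal.mul_mem_left _ _ huF
    have m2 : ∑ i, MvPolynomial.pderiv i g *
        (v * (u * (w i - y i * W) + (δ : MvPolynomial σ K) * b i * W)) ∈ J :=
      sum_mem fun i _ => Ideal.mul_mem_left _ _ (hvJ i)
    have := sub_mem m1 m2
    convert this using 1
    rw [← H2']
    have e1 : ∀ i, MvPolynomial.pderiv i g *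
        (v * (u * (w i - y i * W) + (δ : MvPolynomial σ K) * b i * W)) =
        u * v * (MvPolynomial.pderiv i g * (w i - y i * W)) +
        ((δ : MvPolynomial σ K) * v * W) * (MvPolynomial.pderiv i g * b i) := fun i => by ring
    simp only [e1, Finset.sum_add_distrib, ← Finset.mul_sum]
    ring
end

section
variable {K : Type*} [Field K] {n : ℕ}

lemma eval_chartPoly (F : MvPolynomial (Fin n) K) (j : Fin n) (a : Fin n → K) (haj : a j = 1) :
    MvPolynomial.eval 0 (chartPoly F j a) = MvPolynomial.eval a F := by
  have : (MvPolynomial.aeval (0 : {i : Fin n // i ≠ j} → K)).comp (MvPolynomial.aeval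
      (fun i : Fin n => if h : i = j then (1 : MvPolynomial {i : Fin n // i ≠ j} K)
        else MvPolynomial.X ⟨i, h⟩ + MvPolynomial.C (a i))) =
      MvPolynomial.aeval a := by
    ext i
    by_cases h : i = j
    · subst h; simp [haj]
    · simp [h]
  have := DFunLike.congr_fun this F
  simpa [chartPoly, MvPolynomial.aeval_eq_eval] using this

lemma pderiv_chartPoly (F : MvPolynomial (Fin n) K) (j : Fin n) (a : Fin n → K)
    (i : {i : Fin n // i ≠ j}) :
    MvPolynomial.pderiv i (chartPoly F j a) = chartPoly (MvPolynomial.pderiv i.1 F) j a := by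
  classical
  rw [chartPoly, aeval_chain, Finset.sum_eq_single i.1]
  · rw [dif_neg i.2]
    simp [chartPoly]
  · intro l _ hl
    by_cases h : l = j
    · rw [dif_pos h]; simp
    · rw [dif_neg h, map_add, MvPolynomial.pderiv_X, MvPolynomial.pderiv_C, Pi.single_apply,
        if_neg, add_zero, mul_zero]
      intro h'
      exact hl (congrArg Subtype.val h')
  · simp

/-- section of the chart map -/
def chartSec (j : Fin n) (a : Fin n → K) :
    MvPolynomial {i : Fin n // i ≠ j} K →ₐ[K] MvPolynomial (Fin n) K :=
  MvPolynomial.aeval fun i => MvPolynomial.X i.1 - MvPolynomial.C (a i.1)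

lemma chartSec_chartPoly (F : MvPolynomial (Fin n) K) (j : Fin n) (a : Fin n → K) :
    F - chartSec j a (chartPoly F j a) ∈ Ideal.span {(MvPolynomial.X j - 1 : MvPolynomial (Fin n) K)} := by
  rw [chartPoly, MvPolynomial.comp_aeval_apply]
  have := aeval_sub_mem (K := K) (Ideal.span {(MvPolynomial.X j - 1 : MvPolynomial (Fin n) K)})
    MvPolynomial.X (fun i => chartSec j a (if h : i = j then 1
        else MvPolynomial.X ⟨i, h⟩ + MvPolynomial.C (a i))) ?_ F
  · rw [MvPolynomial.aeval_X_left_apply] at this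
    exact this
  · intro i
    by_cases h : i = j
    · subst h
      simpa using Ideal.mem_span_singleton_self _
    · rw [dif_neg h, map_add, chartSec, MvPolynomial.aeval_X, MvPolynomial.aeval_C]
      simp [MvPolynomial.algebraMap_eq]

lemma eval_chartSec (q : MvPolynomial {i : Fin n // i ≠ j} K) (a : Fin n → K) :
    MvPolynomial.eval a (chartSec j a q) = MvPolynomial.eval 0 q := by
  have : (MvPolynomial.aeval a).comp (chartSec j a) =
      MvPolynomial.aeval (0 : {i : Fin n // i ≠ j} → K) := by
    ext i; simp [chartSec]
  have := DFunLike.congr_fun this q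
  simpa [MvPolynomial.aeval_eq_eval] using this

lemma chart_local [IsAlgClosed K] (F G : MvPolynomial (Fin n) K) (j : Fin n) (a : Fin n → K)
    (haj : a j = 1) (δ δ' : ℕ) (hF : F.IsHomogeneous δ) (hG : G.IsHomogeneous δ')
    (hδ' : (δ' : K) ≠ 0) (hFa : MvPolynomial.eval a F = 0)
    (hiso : IsIsolatedCriticalAtZero (chartPoly F j a))
    (d : ℕ) (hd : (d : K) ≠ 0) (hw : WeightedHomogSing (chartPoly F j a) d)
    (hGa : MvPolynomial.eval a G ≠ 0) (ω ξ : Fin n → MvPolynomial (Fin n) K)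
    (h1 : ∑ i, MvPolynomial.pderiv i F * ω i = 0)
    (h2 : ∑ i, MvPolynomial.pderiv i G * ω i = ∑ i, MvPolynomial.pderiv i F * ξ i) :
    ∃ q : MvPolynomial (Fin n) K, MvPolynomial.eval a q ≠ 0 ∧
      q * ω j ∈ Ideal.span {y | ∃ i : Fin n, i ≠ j ∧ y = MvPolynomial.pderiv i F} ⊔
        Ideal.span {MvPolynomial.X j - 1} := by
  classical
  let θ : MvPolynomial (Fin n) K →ₐ[K] MvPolynomial {i : Fin n // i ≠ j} K :=
    MvPolynomial.aeval
      (fun i : Fin n => if h : i = j then (1 : MvPolynomial {i : Fin n // i ≠ j} K)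
        else MvPolynomial.X ⟨i, h⟩ + MvPolynomial.C (a i))
  have hθ : ∀ f, chartPoly f j a = θ f := fun f => rfl
  have hθd : ∀ f (i : {i : Fin n // i ≠ j}), MvPolynomial.pderiv i (θ f) =
    θ (MvPolynomial.pderiv i.1 f) := fun f i => pderiv_chartPoly f j a i
  have hsplit : ∀ x : Fin n → MvPolynomial {i : Fin n // i ≠ j} K,
      ∑ i, x i = ∑ i : {i : Fin n // i ≠ j}, x i.1 + x j := by
    intro x
    rw [Fintype.sum_eq_add_sum_subtype_ne x j, add_comm]
  have hθj : θ (MvPolynomial.X j) = 1 := by simp [θ]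
  have hEul : ∀ (f : MvPolynomial (Fin n) K) (m : ℕ), f.IsHomogeneous m →
      ∑ i : {i : Fin n // i ≠ j}, θ (MvPolynomial.X i.1) * MvPolynomial.pderiv i (θ f) +
        θ (MvPolynomial.pderiv j f) = (m : MvPolynomial {i : Fin n // i ≠ j} K) * θ f := by
    intro f m hf
    have := congrArg θ hf.sum_X_mul_pderiv
    rw [map_sum, hsplit, nsmul_eq_mul, map_mul, map_mul, hθj, one_mul, map_natCast] at this
    simpa only [map_mul, hθd] using this
  obtain ⟨q, hq, hqJ⟩ := local_core (θ F) (θ G) δ δ' hδ' hiso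
    (by rw [← hθ, eval_chartPoly F j a haj, hFa]) d hd hw
    (by rw [← hθ, eval_chartPoly G j a haj]; exact hGa)
    (fun i => θ (MvPolynomial.X i.1)) (fun i => θ (ω i.1)) (fun i => θ (ξ i.1))
    (θ (ω j)) (θ (ξ j)) (θ (MvPolynomial.pderiv j F)) (θ (MvPolynomial.pderiv j G))
    (hEul F δ hF) (hEul G δ' hG)
    (by
      have := congrArg θ h1
      rw [map_sum, hsplit, map_zero] at this
      simpa only [map_mul, hθd] using this)
    (by
      have := congrArg θ h2
      rw [map_sum, map_sum, hsplit, hsplit] at this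
      simpa only [map_mul, hθd] using this)
  refine ⟨chartSec j a q, by rwa [eval_chartSec], ?_⟩
  set Q := Ideal.span {y | ∃ i : Fin n, i ≠ j ∧ y = MvPolynomial.pderiv i F} ⊔
        Ideal.span {(MvPolynomial.X j - 1 : MvPolynomial (Fin n) K)} with hQ
  have hk : ∀ f, f - chartSec j a (θ f) ∈ Q := fun f =>
    Ideal.mem_sup_right (chartSec_chartPoly f j a)
  have hI : Ideal.map (chartSec j a).toRingHom
      (Ideal.span (Set.range fun i => MvPolynomial.pderiv i (θ F))) ≤ Q := by
    rw [Ideal.map_span, Ideal.span_le]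
    rintro _ ⟨_, ⟨i, rfl⟩, rfl⟩
    have m1 : MvPolynomial.pderiv i.1 F ∈ Q :=
      Ideal.mem_sup_left (Ideal.subset_span ⟨i.1, i.2, rfl⟩)
    have := sub_mem m1 (hk (MvPolynomial.pderiv i.1 F))
    rw [sub_sub_cancel, ← hθd] at this
    exact this
  have m2 := hI (Ideal.mem_map_of_mem _ hqJ)
  have m3 : chartSec j a q * (ω j - chartSec j a (θ (ω j))) ∈ Q := Ideal.mul_mem_left _ _ (hk _)
  have := add_mem m3 m2
  convert this using 1
  change _ = _ + chartSec j a (q * θ (ω j))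
  rw [map_mul]; ring

/-- homogenization with respect to `X j` in degree `D` -/
def homz (j : Fin n) (D : ℕ) : MvPolynomial (Fin n) K →ₗ[K] MvPolynomial (Fin n) K :=
  ∑ d ∈ Finset.range (D + 1),
    (LinearMap.mulLeft K (MvPolynomial.X j ^ (D - d))).comp (MvPolynomial.homogeneousComponent d)

lemma homz_apply (j : Fin n) (D : ℕ) (f : MvPolynomial (Fin n) K) :
    homz j D f = ∑ d ∈ Finset.range (D + 1),
      MvPolynomial.X j ^ (D - d) * MvPolynomial.homogeneousComponent d f := by
  simp [homz, LinearMap.sum_apply]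

lemma homz_homog (j : Fin n) (D d : ℕ) (f : MvPolynomial (Fin n) K) (hf : f.IsHomogeneous d) :
    homz j D f = if d ≤ D then MvPolynomial.X j ^ (D - d) * f else 0 := by
  have hc : ∀ e, MvPolynomial.homogeneousComponent e f = if e = d then f else 0 := fun e =>
    MvPolynomial.homogeneousComponent_of_mem ((MvPolynomial.mem_homogeneousSubmodule d f).2 hf)
  rw [homz_apply]
  simp only [hc, mul_ite, mul_zero, Finset.sum_ite_eq', Finset.mem_range, Nat.lt_succ_iff]

lemma homz_isHomogeneous (j : Fin n) (D : ℕ) (f : MvPolynomial (Fin n) K) :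
    (homz j D f).IsHomogeneous D := by
  rw [homz_apply]
  refine MvPolynomial.IsHomogeneous.sum _ _ _ fun d hd => ?_
  have h1 := ((MvPolynomial.isHomogeneous_X K j).pow (D - d)).mul
    (MvPolynomial.homogeneousComponent_isHomogeneous d f)
  rw [Finset.mem_range] at hd
  convert h1 using 1
  omega

lemma sum_hc (f : MvPolynomial (Fin n) K) (D : ℕ) (hD : f.totalDegree ≤ D) :
    ∑ d ∈ Finset.range (D + 1), MvPolynomial.homogeneousComponent d f = f := by
  conv_rhs => rw [← MvPolynomial.sum_homogeneousComponent f]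
  symm
  refine Finset.sum_subset (Finset.range_mono (by omega)) fun d _ hd => ?_
  rw [Finset.mem_range, not_lt] at hd
  exact MvPolynomial.homogeneousComponent_eq_zero _ _ (by omega)

lemma homz_mem (j : Fin n) (D : ℕ) (S : Set (MvPolynomial (Fin n) K)) (m : ℕ)
    (hS : ∀ f ∈ S, f.IsHomogeneous m) (f : MvPolynomial (Fin n) K) (hf : f ∈ Ideal.span S) :
    homz j D f ∈ Ideal.span S := by
  have key : ∀ c, ∀ G ∈ S, homz j D (c * G) ∈ Ideal.span S := by
    intro c G hG
    rw [← MvPolynomial.sum_homogeneousComponent c, Finset.sum_mul, map_sum]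
    refine sum_mem fun e _ => ?_
    rw [homz_homog j D (e + m) _
      ((MvPolynomial.homogeneousComponent_isHomogeneous e c).mul (hS G hG))]
    split_ifs
    · exact Ideal.mul_mem_left _ _ (Ideal.mul_mem_left _ _ (Ideal.subset_span hG))
    · exact zero_mem _
  rw [Ideal.span, Submodule.mem_span_iff_exists_finset_subset] at hf
  obtain ⟨c, t, ht, -, rfl⟩ := hf
  rw [map_sum]
  exact sum_mem fun G hG => key _ G (ht hG)

lemma homz_X_sub_one (j : Fin n) (D : ℕ) (z : MvPolynomial (Fin n) K) (hD : z.totalDegree < D) :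
    homz j D (z * (MvPolynomial.X j - 1)) = 0 := by
  rw [← sum_hc z z.totalDegree le_rfl, Finset.sum_mul, map_sum]
  refine Finset.sum_eq_zero fun d hd => ?_
  rw [Finset.mem_range] at hd
  have hz := MvPolynomial.homogeneousComponent_isHomogeneous d z
  rw [mul_sub, mul_one, map_sub, homz_homog j D d _ hz, homz_homog j D (d + 1) _
    (hz.mul (MvPolynomial.isHomogeneous_X K j)), if_pos (by omega), if_pos (by omega)]
  have : D - d = (D - (d + 1)) + 1 := by omega
  rw [this, pow_succ]; ring

lemma homz_mul (j : Fin n) (D k : ℕ) (q w : MvPolynomial (Fin n) K) (hw : w.IsHomogeneous k)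
    (hD : q.totalDegree ≤ D) : homz j (D + k) (q * w) = homz j D q * w := by
  conv_lhs => rw [← sum_hc q D hD]
  rw [Finset.sum_mul, map_sum, homz_apply, Finset.sum_mul]
  refine Finset.sum_congr rfl fun d hd => ?_
  rw [Finset.mem_range] at hd
  rw [homz_homog j (D + k) (d + k) _
    ((MvPolynomial.homogeneousComponent_isHomogeneous d q).mul hw), if_pos (by omega),
    Nat.add_sub_add_right, mul_assoc]

lemma eval_homz (j : Fin n) (D : ℕ) (q : MvPolynomial (Fin n) K) (hD : q.totalDegree ≤ D)
    (a : Fin n → K) (ha : a j = 1) :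
    MvPolynomial.eval a (homz j D q) = MvPolynomial.eval a q := by
  conv_rhs => rw [← sum_hc q D hD]
  rw [homz_apply, map_sum, map_sum]
  simp [ha]

lemma globalize [IsAlgClosed K] (F w : MvPolynomial (Fin n) K) (j : Fin n) (δ k : ℕ)
    (hF : F.IsHomogeneous δ) (hw : w.IsHomogeneous k)
    (hloc : ∀ a : Fin n → K, a j = 1 → (∀ i, MvPolynomial.eval a (MvPolynomial.pderiv i F) = 0) →
      ∃ q : MvPolynomial (Fin n) K, MvPolynomial.eval a q ≠ 0 ∧
      q * w ∈ Ideal.span {y | ∃ i : Fin n, i ≠ j ∧ y = MvPolynomial.pderiv i F} ⊔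
        Ideal.span {MvPolynomial.X j - 1}) :
    ∃ (P : MvPolynomial (Fin n) K) (D : ℕ), P.IsHomogeneous D ∧
      P * w ∈ Ideal.span {y | ∃ i : Fin n, i ≠ j ∧ y = MvPolynomial.pderiv i F} ∧
      ∀ a : Fin n → K, a j = 1 → (∀ i, MvPolynomial.eval a (MvPolynomial.pderiv i F) = 0) →
        MvPolynomial.eval a P = 1 := by
  set S : Set (MvPolynomial (Fin n) K) := {y | ∃ i : Fin n, i ≠ j ∧ y = MvPolynomial.pderiv i F} with hS
  set Q := Ideal.span S ⊔ Ideal.span {(MvPolynomial.X j - 1 : MvPolynomial (Fin n) K)} with hQ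
  let 𝔮 : Ideal (MvPolynomial (Fin n) K) := Submodule.comap (LinearMap.mulRight (MvPolynomial (Fin n) K) w) Q
  have hmem : ∀ q, q ∈ 𝔮 ↔ q * w ∈ Q := fun q => Iff.rfl
  let JF := Ideal.span (Set.range fun i => MvPolynomial.pderiv i F)
  have htop : 𝔮 ⊔ JF = ⊤ := by
    rw [← Ideal.radical_eq_top, ← MvPolynomial.vanishingIdeal_zeroLocus_eq_radical (K := K),
      Ideal.eq_top_iff_one, MvPolynomial.mem_vanishingIdeal_iff]
    intro a ha
    rw [MvPolynomial.mem_zeroLocus_iff] at ha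
    exfalso
    simp only [MvPolynomial.aeval_eq_eval] at ha
    have haj : a j = 1 := by
      have := ha (MvPolynomial.X j - 1) (Ideal.mem_sup_left ((hmem _).2
        (Ideal.mul_mem_right _ _ (Ideal.mem_sup_right (Ideal.mem_span_singleton_self _)))))
      simpa [sub_eq_zero] using this
    obtain ⟨q, hq, hqw⟩ := hloc a haj fun i =>
      ha _ (Ideal.mem_sup_right (Ideal.subset_span ⟨i, rfl⟩))
    exact hq (ha q (Ideal.mem_sup_left hqw))
  have h1 : (1 : MvPolynomial (Fin n) K) ∈ 𝔮 ⊔ JF := by rw [htop]; trivial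
  obtain ⟨q, hq, r, hr, hqr⟩ := Submodule.mem_sup.1 h1
  have hq' := (hmem q).1 hq
  obtain ⟨s, hs, t, ht, hst⟩ := Submodule.mem_sup.1 hq'
  obtain ⟨z, rfl⟩ := Ideal.mem_span_singleton'.1 ht
  obtain ⟨D, hD1, hD2⟩ : ∃ D, q.totalDegree ≤ D ∧ z.totalDegree < D :=
    ⟨q.totalDegree + z.totalDegree + 1, by omega, by omega⟩
  refine ⟨homz j D q, D, homz_isHomogeneous j D q, ?_, ?_⟩
  · rw [← homz_mul j D k q w hw hD1, ← hst, map_add, homz_X_sub_one j (D + k) z (by omega),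
      add_zero]
    refine homz_mem j (D + k) S (δ - 1) ?_ s hs
    rintro _ ⟨i, -, rfl⟩
    exact hF.pderiv
  · intro a haj ha
    rw [eval_homz j D q hD1 a haj]
    have hr0 : MvPolynomial.eval a r = 0 := by
      have : JF ≤ RingHom.ker (MvPolynomial.eval a) := by
        rw [Ideal.span_le]; rintro _ ⟨i, rfl⟩; exact ha i
      exact this hr
    have := congrArg (MvPolynomial.eval a) hqr
    rwa [map_add, hr0, add_zero, map_one] at this
end

lemma homog_eval_smul {K : Type*} [Field K] {n : ℕ} (f : MvPolynomial (Fin n) K) (d : ℕ)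
    (hf : f.IsHomogeneous d) (c : K) (a : Fin n → K) :
    MvPolynomial.eval (c • a) f = c ^ d * MvPolynomial.eval a f := by
  rw [MvPolynomial.eval_eq', MvPolynomial.eval_eq', Finset.mul_sum]
  refine Finset.sum_congr rfl fun m hm => ?_
  have h1 : ∑ i, m i = d := by
    rw [← Finsupp.degree_eq_sum]
    rw [Finsupp.degree_eq_weight_one]
    exact hf (MvPolynomial.mem_support_iff.1 hm)
  simp only [Pi.smul_apply, smul_eq_mul, mul_pow, Finset.prod_mul_distrib, Finset.prod_pow_eq_pow_sum,
    h1]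
  ring

/-- Lemma 3.17: under Hypothesis (A), assuming no singular point of `f^(δ) = 0` lies on the
hyperplane `x_n = 0` and that `f^(δ)(x_1,…,x_{n-1},0) = 0` is a smooth hypersurface in
`ℙ^{n-2}`, given homogeneous `ω_1,…,ω_n` and `ξ_1,…,ξ_n` with
`∑ (∂f^(δ)/∂x_i) ω_i = 0` and `∑ (∂f^(δ')/∂x_i) ω_i = ∑ (∂f^(δ)/∂x_i) ξ_i`,
there is a homogeneous `P` with
`P ω_n ∈ (∂f^(δ)/∂x_1, …, ∂f^(δ)/∂x_{n-1})` not vanishing at any singular point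
of `f^(δ) = 0`. -/
theorem statement11 {K : Type*} [Field K] [IsAlgClosed K] (p : ℕ) [CharP K p]
    (hp : p.Prime) {n : ℕ} (hn : 2 ≤ n) (f : MvPolynomial (Fin n) K) (δ δ' : ℕ)
    (hsetup : Setup δ δ' f) (hA : HypA p δ δ' f)
    (hchart : ∀ a : Fin n → K, a ≠ 0 →
      eval a (homogeneousComponent δ f) = 0 →
      (∀ i, eval a (pderiv i (homogeneousComponent δ f)) = 0) →
      a ⟨n - 1, by omega⟩ ≠ 0)
    (hsmooth : SmoothProj (truncAtLast (homogeneousComponent δ f)))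
    (ω ξ : Fin n → MvPolynomial (Fin n) K)
    (hω : ∀ i, ∃ d, (ω i).IsHomogeneous d)
    (hξ : ∀ i, ∃ d, (ξ i).IsHomogeneous d)
    (h1 : ∑ i, pderiv i (homogeneousComponent δ f) * ω i = 0)
    (h2 : ∑ i, pderiv i (homogeneousComponent δ' f) * ω i
        = ∑ i, pderiv i (homogeneousComponent δ f) * ξ i) :
    ∃ P : MvPolynomial (Fin n) K,
      (∃ d, P.IsHomogeneous d) ∧
      P * ω ⟨n - 1, by omega⟩ ∈
        Ideal.span {y | ∃ i : Fin n, (i : ℕ) < n - 1 ∧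
          y = pderiv i (homogeneousComponent δ f)} ∧
      ∀ a : Fin n → K, a ≠ 0 →
        eval a (homogeneousComponent δ f) = 0 →
        (∀ i, eval a (pderiv i (homogeneousComponent δ f)) = 0) →
        eval a P ≠ 0 := by
  classical
  set j : Fin n := ⟨n - 1, by omega⟩ with hj
  set F := homogeneousComponent δ f with hFdef
  set G := homogeneousComponent δ' f with hGdef
  have hF : F.IsHomogeneous δ := homogeneousComponent_isHomogeneous δ f
  have hG : G.IsHomogeneous δ' := homogeneousComponent_isHomogeneous δ' f
  obtain ⟨hpδ, hpδ', hsing⟩ := hA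
  have hcast : ∀ m : ℕ, ¬ p ∣ m → (m : K) ≠ 0 := fun m hm h => hm ((CharP.cast_eq_zero_iff K p m).1 h)
  have hI : {y | ∃ i : Fin n, i ≠ j ∧ y = pderiv i F} =
      {y | ∃ i : Fin n, (i : ℕ) < n - 1 ∧ y = pderiv i F} := by
    ext y
    simp only [Set.mem_setOf_eq]
    refine exists_congr fun i => and_congr_left fun _ => ?_
    rw [hj, Ne, Fin.ext_iff]
    have := i.2
    simp only
    omega
  obtain ⟨k, hk⟩ := hω j
  obtain ⟨P, D, hP, hPI, hPa⟩ := globalize F (ω j) j δ k hF hk (by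
    intro a haj ha
    have hFa : eval a F = 0 := by
      have := congrArg (eval a) hF.sum_X_mul_pderiv
      simp only [map_sum, map_mul, ha, mul_zero, Finset.sum_const_zero, nsmul_eq_mul,
        map_natCast] at this
      exact (mul_eq_zero.1 this.symm).resolve_left (hcast δ hpδ)
    obtain ⟨hiso, ⟨d, hd, hw⟩, hGa⟩ := hsing a j haj hFa ha
    exact chart_local F G j a haj δ δ' hF hG (hcast δ' hpδ') hFa hiso d (hcast d hd) hw hGa
      ω ξ h1 h2)
  refine ⟨P, ⟨D, hP⟩, by rw [← hI]; exact hPI, ?_⟩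
  intro a ha0 hFa ha
  have haj : a j ≠ 0 := hchart a ha0 hFa ha
  have h3 := hPa ((a j)⁻¹ • a) (by simp [haj]) (fun i => by
    rw [homog_eval_smul _ (δ - 1) hF.pderiv, ha i, mul_zero])
  rw [homog_eval_smul _ D hP] at h3
  intro h0
  rw [h0, mul_zero] at h3
  exact zero_ne_one h3

end
end
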